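/- arXiv:1802.07581 — 4 statements merged into one kernel-verified Lean document; each statement's English description precedes it below -/
import Mathlib

section
/- Let k : X × X → ℝ be a bounded measurable symmetric positive semidefinite kernel on a Polish space X with 0 ≤ k(·,·) ≤ K, and let P be a Borel probability measure on X. Let y_1,…,y_m and x_1,…,x_n all be i.i.d. with law P (the two samples independent of each other), with empirical measures P̂_m and Q̂_n. Then for every ε > 0, Prob( d_k(P̂_m, Q̂_n) > 2·sqrt(K/m) + 2·sqrt(K/n) + ε ) ≤ 2·exp( −ε² m n / (2K(m+n)) ). -/
open MeasureTheory Filter Topology ENNReal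
open scoped Classical

noncomputable section
/-- The empirical measure `(1/n) ∑_{i<n} δ_{x i}` of a sample, as a probability measure
(junk value for `n = 0`). -/
def empMeas {X : Type*} [MeasurableSpace X] [Nonempty X] (n : ℕ) (x : Fin n → X) :
    ProbabilityMeasure X :=
  if h : 0 < n then
    ⟨(n : ℝ≥0∞)⁻¹ • ∑ i, Measure.dirac (x i), by
      constructor
      simp only [Measure.smul_apply, smul_eq_mul, Measure.coe_finset_sum, Finset.sum_apply,
        measure_univ, Finset.sum_const, Finset.card_univ, Fintype.card_fin, nsmul_eq_mul, mul_one]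
      exact ENNReal.inv_mul_cancel (by exact_mod_cast h.ne') (by simp)⟩
  else ⟨Measure.dirac (Classical.arbitrary X), inferInstance⟩
/-- The squared Maximum Mean Discrepancy associated with the kernel `k`. -/
def mmdSq {X : Type*} [MeasurableSpace X] (k : X → X → ℝ) (P Q : Measure X) : ℝ :=
  (∫ y, ∫ y', k y y' ∂P ∂P) + (∫ x, ∫ x', k x x' ∂Q ∂Q) - 2 * ∫ y, ∫ x, k y x ∂Q ∂P

/-- The Maximum Mean Discrepancy `d_k`, the nonnegative square root of `mmdSq`. -/
def mmd {X : Type*} [MeasurableSpace X] (k : X → X → ℝ) (P Q : Measure X) : ℝ :=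
  Real.sqrt (mmdSq k P Q)

open ProbabilityTheory
open scoped NNReal RealInnerProductSpace

lemma hasSubgaussianMGF_prod {Ω Ω' : Type*} [MeasurableSpace Ω] [MeasurableSpace Ω']
    {μ : Measure Ω} {ν : Measure Ω'} [IsProbabilityMeasure μ] [IsProbabilityMeasure ν]
    {f : Ω × Ω' → ℝ} (hf : Measurable f) {C : ℝ} (hC : ∀ p, |f p| ≤ C) {cX cY : ℝ≥0}
    (hX : ∀ y, HasSubgaussianMGF (fun x => f (x, y) - ∫ x, f (x, y) ∂μ) cX μ)
    (hY : HasSubgaussianMGF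
      (fun y => (∫ x, f (x, y) ∂μ) - ∫ p, f p ∂(μ.prod ν)) cY ν) :
    HasSubgaussianMGF (fun p => f p - ∫ p, f p ∂(μ.prod ν)) (cX + cY) (μ.prod ν) := by
  set M := ∫ p, f p ∂(μ.prod ν)
  have h_int (t : ℝ) : Integrable (fun p => Real.exp (t * (f p - M))) (μ.prod ν) :=
    integrable_exp_mul_of_mem_Icc (a := -C - M) (b := C - M) (by fun_prop)
      (ae_of_all _ fun p => by
        have := abs_le.1 (hC p)
        constructor <;> linarith)
  refine ⟨h_int, fun t => ?_⟩
  have hsplit (y : Ω') : ∫ x, Real.exp (t * (f (x, y) - M)) ∂μ =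
      Real.exp (t * ((∫ x, f (x, y) ∂μ) - M)) *
        mgf (fun x => f (x, y) - ∫ x, f (x, y) ∂μ) μ t := by
    rw [mgf, ← integral_const_mul]
    refine integral_congr_ae (ae_of_all _ fun x => ?_)
    simp only [← Real.exp_add]
    ring_nf
  calc mgf (fun p => f p - M) (μ.prod ν) t
      = ∫ y, ∫ x, Real.exp (t * (f (x, y) - M)) ∂μ ∂ν := integral_prod_symm _ (h_int t)
    _ ≤ ∫ y, Real.exp (t * ((∫ x, f (x, y) ∂μ) - M)) * Real.exp (cX * t ^ 2 / 2) ∂ν := by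
        refine integral_mono (h_int t).integral_prod_right ((hY.integrable_exp_mul t).mul_const _)
          fun y => ?_
        simp only [hsplit]
        gcongr
        exact (hX y).mgf_le t
    _ ≤ Real.exp (cY * t ^ 2 / 2) * Real.exp (cX * t ^ 2 / 2) := by
        rw [integral_mul_const]
        gcongr
        exact hY.mgf_le t
    _ = Real.exp (((cX + cY : ℝ≥0) : ℝ) * t ^ 2 / 2) := by
        rw [← Real.exp_add]
        push_cast
        ring_nf

lemma hasSubgaussianMGF_of_abs_sub_le {Ω : Type*} [MeasurableSpace Ω] {μ : Measure Ω}
    [IsProbabilityMeasure μ] {f : Ω → ℝ} (hf : Measurable f) {c : ℝ≥0}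
    (hc : ∀ x y, |f x - f y| ≤ c) :
    HasSubgaussianMGF (fun x => f x - ∫ x, f x ∂μ) ((c / 2) ^ 2) μ := by
  have : Nonempty Ω := nonempty_of_isProbabilityMeasure μ
  have x₀ := Classical.arbitrary Ω
  have hbdd : BddBelow (Set.range f) :=
    ⟨f x₀ - c, by rintro _ ⟨y, rfl⟩; linarith [(abs_le.1 (hc x₀ y)).2]⟩
  have h := hasSubgaussianMGF_of_mem_Icc (μ := μ) (X := f) (a := ⨅ x, f x) (b := (⨅ x, f x) + c)
    hf.aemeasurable (ae_of_all _ fun x => ⟨ciInf_le hbdd x, by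
      have : f x - c ≤ ⨅ x, f x := le_ciInf fun y => by linarith [(abs_le.1 (hc x y)).2]
      linarith⟩)
  simpa using h

theorem hasSubgaussianMGF_of_bounded_differences_fin {α : Type*} [MeasurableSpace α] {N : ℕ}
    (μ : Fin N → Measure α) [∀ i, IsProbabilityMeasure (μ i)] (c : Fin N → ℝ≥0)
    {f : (Fin N → α) → ℝ} (hf : Measurable f) {C : ℝ} (hC : ∀ z, |f z| ≤ C)
    (hd : ∀ i z a, |f (Function.update z i a) - f z| ≤ c i) :
    HasSubgaussianMGF (fun z => f z - ∫ z, f z ∂(Measure.pi μ)) (∑ i, (c i / 2) ^ 2)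
      (Measure.pi μ) := by
  induction N with
  | zero =>
    have : (fun z => f z - ∫ z, f z ∂(Measure.pi μ)) = fun _ => 0 := by
      funext z
      simp [integral_unique, Subsingleton.elim z default]
    rw [this]
    simp
  | succ N ih =>
    set e := MeasurableEquiv.piFinSuccAbove (fun _ : Fin (N + 1) => α) 0
    have he := measurePreserving_piFinSuccAbove μ 0
    set ν := Measure.pi fun j => μ ((0 : Fin (N + 1)).succAbove j)
    set g : α × (Fin N → α) → ℝ := fun p => f (e.symm p) with hg_def
    have hg : Measurable g := hf.comp e.symm.measurable
    have hgC p : |g p| ≤ C := hC _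
    have hcons p : e.symm p = Fin.cons p.1 p.2 := by
      simp [e, MeasurableEquiv.piFinSuccAbove, Fin.insertNthEquiv]
    have hgint y : Integrable (fun x => g (x, y)) (μ 0) :=
      Integrable.of_bound (hg.comp (by fun_prop)).aestronglyMeasurable C
        (ae_of_all _ fun x => hgC _)
    have hprod : HasSubgaussianMGF (fun p => g p - ∫ p, g p ∂((μ 0).prod ν))
        ((c 0 / 2) ^ 2 + ∑ i : Fin N, (c i.succ / 2) ^ 2) ((μ 0).prod ν) := by
      refine hasSubgaussianMGF_prod hg hgC (fun y => ?_) ?_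
      · refine hasSubgaussianMGF_of_abs_sub_le (hg.comp (by fun_prop)) fun a b => ?_
        have := hd 0 (Fin.cons b y) a
        simpa [hg_def, hcons] using this
      · have h_int : ∫ p, g p ∂((μ 0).prod ν) = ∫ y, ∫ x, g (x, y) ∂(μ 0) ∂ν :=
          integral_prod_symm _ (Integrable.of_bound hg.aestronglyMeasurable C
            (ae_of_all _ fun x => hgC _))
        rw [h_int]
        refine ih _ (fun i => c i.succ) (f := fun y => ∫ x, g (x, y) ∂(μ 0)) ?_ (fun y => ?_)
          fun i y a => ?_
        · exact (hg.stronglyMeasurable.integral_prod_left').measurable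
        · simpa using norm_integral_le_of_norm_le_const (μ := μ 0) (f := fun x => g (x, y))
            (ae_of_all _ fun x => hgC (x, y))
        · rw [← integral_sub (hgint _) (hgint _)]
          simpa using norm_integral_le_of_norm_le_const (μ := μ 0)
            (f := fun x => g (x, Function.update y i a) - g (x, y)) (C := c i.succ)
            (ae_of_all _ fun x => by
              have := hd i.succ (Fin.cons x y) a
              simpa [hg_def, hcons, ← Fin.cons_update] using this)
    rw [Fin.sum_univ_succ]
    have hge z : g (e z) = f z := congrArg f (e.symm_apply_apply z)
    have hmean : ∫ p, g p ∂((μ 0).prod ν) = ∫ z, f z ∂(Measure.pi μ) := by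
      rw [← he.integral_comp' g]
      exact integral_congr_ae (ae_of_all _ hge)
    rw [← he.map_eq] at hprod
    have := HasSubgaussianMGF.of_map he.measurable.aemeasurable hprod
    rw [he.map_eq, hmean] at this
    exact this.congr (ae_of_all _ fun z => congrArg (· - _) (hge z))

/-- **McDiarmid inequality**, sub-Gaussian form: a bounded measurable function of independent
variables that changes by at most `c i` when the `i`-th variable is altered is sub-Gaussian around
its mean, with parameter `∑ i, (c i / 2) ^ 2`. -/
theorem hasSubgaussianMGF_of_bounded_differences {ι α : Type*} [Fintype ι] [MeasurableSpace α]
    (μ : ι → Measure α) [∀ i, IsProbabilityMeasure (μ i)] (c : ι → ℝ≥0)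
    {f : (ι → α) → ℝ} (hf : Measurable f) {C : ℝ} (hC : ∀ z, |f z| ≤ C)
    (hd : ∀ i z a, |f (Function.update z i a) - f z| ≤ c i) :
    HasSubgaussianMGF (fun z => f z - ∫ z, f z ∂(Measure.pi μ)) (∑ i, (c i / 2) ^ 2)
      (Measure.pi μ) := by
  set σ := (Fintype.equivFin ι).symm
  set e := MeasurableEquiv.piCongrLeft (fun _ : ι => α) σ
  have he := measurePreserving_piCongrLeft μ σ
  have happ (z : Fin (Fintype.card ι) → α) : e z = z ∘ σ.symm := by
    funext i
    obtain ⟨j, rfl⟩ := σ.surjective i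
    simp [e, MeasurableEquiv.piCongrLeft_apply_apply]
  have h := hasSubgaussianMGF_of_bounded_differences_fin (fun i => μ (σ i)) (fun i => c (σ i))
    (f := fun z => f (e z)) (hf.comp e.measurable) (fun z => hC _) fun i z a => by
      have := hd (σ i) (z ∘ σ.symm) a
      rw [happ, happ]
      convert this using 4
      funext j
      simp [Function.update_apply, Equiv.symm_apply_eq]
  have hmean : ∫ z, f (e z) ∂(Measure.pi fun i => μ (σ i)) = ∫ z, f z ∂(Measure.pi μ) :=
    he.integral_comp' f
  rw [σ.sum_comp (fun i => (c i / 2) ^ 2), hmean] at h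
  have := (he.symm _).measurable.aemeasurable (μ := Measure.pi μ)
  rw [← (he.symm _).map_eq] at h
  exact (HasSubgaussianMGF.of_map this h).congr
    (ae_of_all _ fun z => congrArg (f · - _) (e.apply_symm_apply z))

/-- A symmetric positive semidefinite kernel is the Gram kernel of a map into a semi-inner product
space. -/
theorem exists_feature_map.{u} {X : Type u} (k : X → X → ℝ) (hk_symm : ∀ x y, k x y = k y x)
    (hk_psd : ∀ (N : ℕ) (z : Fin N → X) (c : Fin N → ℝ),
      0 ≤ ∑ i, ∑ j, c i * c j * k (z i) (z j)) :
    ∃ (H : Type u) (_ : SeminormedAddCommGroup H) (_ : InnerProductSpace ℝ H) (φ : X → H),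
      ∀ x y, ⟪φ x, φ y⟫ = k x y := by
  let core : PreInnerProductSpace.Core ℝ (X →₀ ℝ) :=
    { inner := fun f g => f.sum fun x a => g.sum fun y b => a * b * k x y
      conj_inner_symm := fun f g => by
        rw [Finsupp.sum_comm]
        simp only [conj_trivial, hk_symm, mul_comm]
      add_left := fun _ _ _ => by
        rw [Finsupp.sum_add_index'] <;> simp [← Finsupp.sum_add, add_mul]
      smul_left := fun _ _ _ => by
        rw [Finsupp.sum_smul_index] <;> simp [Finsupp.mul_sum, ← mul_assoc]
      re_inner_nonneg := fun f => by
        have := hk_psd f.support.card (fun i => f.support.equivFin.symm i)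
          fun i => f (f.support.equivFin.symm i)
        rw [f.support.equivFin.symm.sum_comp (fun s => ∑ j, f s *
            f (f.support.equivFin.symm j) * k s (f.support.equivFin.symm j))] at this
        simp_rw [fun s : f.support => f.support.equivFin.symm.sum_comp
          (fun r => f s * f r * k s r), fun x => Finset.sum_coe_sort f.support
          (fun r => f x * f r * k x r)] at this
        rw [Finset.sum_coe_sort f.support (fun s => ∑ r ∈ f.support, f s * f r * k s r)] at this
        simpa [Finsupp.sum] using this }
  let _ : SeminormedAddCommGroup (X →₀ ℝ) :=
    InnerProductSpace.Core.toSeminormedAddCommGroup (𝕜 := ℝ) (c := core)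
  let _ : InnerProductSpace ℝ (X →₀ ℝ) := .ofCore core
  refine ⟨X →₀ ℝ, inferInstance, inferInstance, fun x => .single x 1, fun x y => ?_⟩
  change (Finsupp.single x 1).sum (fun x a => (Finsupp.single y 1).sum fun y b => a * b * k x y) = _
  simp

/-- The norm of the signed combination `∑ i, w i • δ_{z i}` in the reproducing kernel Hilbert
space of `k`. -/
def kernelNorm {X ι : Type*} [Fintype ι] (k : X → X → ℝ) (w : ι → ℝ) (z : ι → X) : ℝ :=
  √(∑ i, ∑ j, w i * w j * k (z i) (z j))

lemma measurable_kernel_apply {X ι : Type*} [MeasurableSpace X] {k : X → X → ℝ}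
    (hk_meas : Measurable fun p : X × X => k p.1 p.2)
    (i j : ι) :
    Measurable fun z : ι → X => k (z i) (z j) :=
  hk_meas.comp (g := fun p : X × X => k p.1 p.2) (f := fun z : ι → X => (z i, z j))
    ((measurable_pi_apply i).prodMk (measurable_pi_apply j))

section KernelNorm

variable {X ι : Type*} [Fintype ι] {k : X → X → ℝ} {K : ℝ}

lemma sum_mul_kernel_eq_inner {H : Type*} [SeminormedAddCommGroup H] [InnerProductSpace ℝ H]
    {φ : X → H} (hφ : ∀ x y, ⟪φ x, φ y⟫ = k x y) (w : ι → ℝ) (z : ι → X) :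
    ∑ i, ∑ j, w i * w j * k (z i) (z j) = ⟪∑ i, w i • φ (z i), ∑ i, w i • φ (z i)⟫ := by
  rw [sum_inner]
  simp_rw [inner_sum, real_inner_smul_left, real_inner_smul_right, hφ, mul_assoc]

lemma kernelNorm_eq_norm {H : Type*} [SeminormedAddCommGroup H] [InnerProductSpace ℝ H]
    {φ : X → H} (hφ : ∀ x y, ⟪φ x, φ y⟫ = k x y) (w : ι → ℝ) (z : ι → X) :
    kernelNorm k w z = ‖∑ i, w i • φ (z i)‖ := by
  rw [kernelNorm, norm_eq_sqrt_real_inner, sum_mul_kernel_eq_inner hφ]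

lemma abs_kernelNorm_update_sub_le (hk_symm : ∀ x y, k x y = k y x)
    (hk_psd : ∀ (N : ℕ) (z : Fin N → X) (c : Fin N → ℝ),
      0 ≤ ∑ i, ∑ j, c i * c j * k (z i) (z j))
    (hk_bdd : ∀ x y, k x y ∈ Set.Icc (0 : ℝ) K) (w : ι → ℝ) (i : ι) (z : ι → X) (a : X) :
    |kernelNorm k w (Function.update z i a) - kernelNorm k w z| ≤ |w i| * √(2 * K) := by
  obtain ⟨H, _, _, φ, hφ⟩ := exists_feature_map k hk_symm hk_psd
  rw [kernelNorm_eq_norm hφ, kernelNorm_eq_norm hφ]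
  refine (abs_norm_sub_norm_le _ _).trans ?_
  have hsum : (∑ j, w j • φ (Function.update z i a j)) - ∑ j, w j • φ (z j) =
      w i • (φ a - φ (z i)) := by
    rw [← Finset.sum_sub_distrib, Finset.sum_eq_single i]
    · simp [smul_sub]
    · intro j _ hj
      simp [hj]
    · simp
  rw [hsum, norm_smul, Real.norm_eq_abs]
  gcongr
  refine Real.le_sqrt_of_sq_le ?_
  rw [norm_sub_sq_real, ← real_inner_self_eq_norm_sq, ← real_inner_self_eq_norm_sq, hφ, hφ, hφ]
  linarith [(hk_bdd a a).2, (hk_bdd (z i) (z i)).2, (hk_bdd a (z i)).1]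

lemma abs_kernelNorm_le (hk_bdd : ∀ x y, k x y ∈ Set.Icc (0 : ℝ) K) (w : ι → ℝ) (z : ι → X) :
    |kernelNorm k w z| ≤ √(∑ i, ∑ j, |w i * w j| * K) := by
  rw [kernelNorm, abs_of_nonneg (Real.sqrt_nonneg _)]
  gcongr with i _ j _
  · exact (hk_bdd (z i) (z j)).1
  · exact le_abs_self _
  · exact (hk_bdd (z i) (z j)).2

variable [MeasurableSpace X]

lemma measurable_kernelNorm (hk_meas : Measurable fun p : X × X => k p.1 p.2) (w : ι → ℝ) :
    Measurable (kernelNorm k w) :=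
  (Finset.measurable_sum _ fun i _ => Finset.measurable_sum _ fun j _ =>
    (measurable_kernel_apply hk_meas i j).const_mul _).sqrt

lemma integral_pi_kernel_of_ne (hk_meas : Measurable fun p : X × X => k p.1 p.2)
    (P : Measure X) [IsProbabilityMeasure P] {i j : ι} (hij : i ≠ j) :
    ∫ z, k (z i) (z j) ∂(Measure.pi fun _ : ι => P) = ∫ p, k p.1 p.2 ∂(P.prod P) := by
  have hind := (iIndepFun_pi (μ := fun _ : ι => P) (X := fun _ => id)
    fun _ => aemeasurable_id).indepFun hij
  have hmap := (indepFun_iff_map_prod_eq_prod_map_map (measurable_pi_apply i).aemeasurable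
    (measurable_pi_apply j).aemeasurable).1 hind
  have hmap' : Measure.map (fun z : ι → X => (z i, z j)) (Measure.pi fun _ : ι => P) =
      P.prod P := by
    refine hmap.trans ?_
    congr 1
    · exact (measurePreserving_eval (fun _ : ι => P) i).map_eq
    · exact (measurePreserving_eval (fun _ : ι => P) j).map_eq
  rw [← hmap', integral_map (by fun_prop) hk_meas.aestronglyMeasurable]

lemma integral_kernelNorm_le (hk_meas : Measurable fun p : X × X => k p.1 p.2)
    (hk_bdd : ∀ x y, k x y ∈ Set.Icc (0 : ℝ) K)
    (hk_nonneg : ∀ (w : ι → ℝ) (z : ι → X), 0 ≤ ∑ i, ∑ j, w i * w j * k (z i) (z j))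
    (P : Measure X) [IsProbabilityMeasure P] (w : ι → ℝ) (hw : ∑ i, w i = 0) :
    ∫ z, kernelNorm k w z ∂(Measure.pi fun _ : ι => P) ≤ √(K * ∑ i, w i ^ 2) := by
  set ν := Measure.pi fun _ : ι => P
  have h_int (i j : ι) : Integrable (fun z : ι → X => k (z i) (z j)) ν :=
    Integrable.of_mem_Icc 0 K (measurable_kernel_apply hk_meas i j).aemeasurable
      (ae_of_all _ fun z => hk_bdd _ _)
  set κ := ∫ p, k p.1 p.2 ∂(P.prod P)
  have hκ : 0 ≤ κ := integral_nonneg fun p => (hk_bdd _ _).1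
  have hterm (i j : ι) : w i * w j * ∫ z, k (z i) (z j) ∂ν ≤
      w i * w j * κ + if i = j then K * w i ^ 2 else 0 := by
    by_cases hij : i = j
    · subst hij
      have h1 : ∫ z, k (z i) (z i) ∂ν ≤ K := by
        simpa using integral_mono (h_int i i) (integrable_const K) fun z => (hk_bdd _ _).2
      simp only [if_true]
      nlinarith [mul_self_nonneg (w i), mul_nonneg (mul_self_nonneg (w i)) hκ,
        mul_le_mul_of_nonneg_left h1 (mul_self_nonneg (w i))]
    · simp [hij, ν, κ, integral_pi_kernel_of_ne hk_meas P hij]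
  have hsq : ∫ z, kernelNorm k w z ^ 2 ∂ν ≤ K * ∑ i, w i ^ 2 := by
    calc ∫ z, kernelNorm k w z ^ 2 ∂ν
        = ∑ i, ∑ j, w i * w j * ∫ z, k (z i) (z j) ∂ν := by
          simp_rw [kernelNorm, Real.sq_sqrt (hk_nonneg w _)]
          rw [integral_finsetSum _ fun i _ => integrable_finsetSum _ fun j _ =>
            (h_int i j).const_mul _]
          refine Finset.sum_congr rfl fun i _ => ?_
          rw [integral_finsetSum _ fun j _ => (h_int i j).const_mul _]
          simp_rw [integral_const_mul]
      _ ≤ ∑ i, ∑ j, (w i * w j * κ + if i = j then K * w i ^ 2 else 0) := by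
          gcongr with i _ j _
          exact hterm i j
      _ = K * ∑ i, w i ^ 2 := by
          simp [Finset.sum_add_distrib, ← Finset.sum_mul, ← Finset.mul_sum, hw]
  have hmem : MemLp (kernelNorm k w) 2 ν :=
    MemLp.of_bound (measurable_kernelNorm hk_meas w).aestronglyMeasurable _
      (ae_of_all _ fun z => abs_kernelNorm_le hk_bdd w z)
  refine Real.le_sqrt_of_sq_le (le_trans ?_ hsq)
  have := variance_nonneg (kernelNorm k w) ν
  rw [variance_eq_sub hmem] at this
  simpa using this

theorem measureReal_kernelNorm_ge_le (hk_meas : Measurable fun p : X × X => k p.1 p.2)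
    (hk_symm : ∀ x y, k x y = k y x)
    (hk_psd : ∀ (N : ℕ) (z : Fin N → X) (c : Fin N → ℝ),
      0 ≤ ∑ i, ∑ j, c i * c j * k (z i) (z j))
    (hk_bdd : ∀ x y, k x y ∈ Set.Icc (0 : ℝ) K) (hK : 0 ≤ K)
    (P : Measure X) [IsProbabilityMeasure P] (w : ι → ℝ) (hw : ∑ i, w i = 0)
    {ε : ℝ} (hε : 0 ≤ ε) :
    (Measure.pi fun _ : ι => P).real {z | √(K * ∑ i, w i ^ 2) + ε ≤ kernelNorm k w z} ≤
      Real.exp (-ε ^ 2 / (K * ∑ i, w i ^ 2)) := by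
  have hk_nonneg (w : ι → ℝ) (z : ι → X) : 0 ≤ ∑ i, ∑ j, w i * w j * k (z i) (z j) := by
    obtain ⟨H, _, _, φ, hφ⟩ := exists_feature_map k hk_symm hk_psd
    rw [sum_mul_kernel_eq_inner hφ]
    exact real_inner_self_nonneg
  have hsub := hasSubgaussianMGF_of_bounded_differences (fun _ : ι => P)
    (fun i => (|w i| * √(2 * K)).toNNReal) (measurable_kernelNorm hk_meas w)
    (abs_kernelNorm_le hk_bdd w) fun i z a => by
      rw [Real.coe_toNNReal _ (by positivity)]
      exact abs_kernelNorm_update_sub_le hk_symm hk_psd hk_bdd w i z a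
  have hmean := integral_kernelNorm_le hk_meas hk_bdd hk_nonneg P w hw
  have hvar : 2 * ((∑ i, ((|w i| * √(2 * K)).toNNReal / 2) ^ 2 : ℝ≥0) : ℝ) =
      K * ∑ i, w i ^ 2 := by
    push_cast
    rw [Finset.mul_sum, Finset.mul_sum]
    refine Finset.sum_congr rfl fun i _ => ?_
    rw [Real.coe_toNNReal _ (by positivity), div_pow, mul_pow, sq_abs,
      Real.sq_sqrt (by positivity)]
    ring
  have hchernoff := hsub.measure_ge_le hε
  rw [hvar] at hchernoff
  refine (measureReal_mono fun z hz => ?_).trans hchernoff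
  simp only [Set.mem_ofPred_eq] at hz ⊢
  linarith

end KernelNorm

lemma integral_empMeas {X : Type*} [MeasurableSpace X] [Nonempty X] {n : ℕ} (hn : 0 < n)
    (x : Fin n → X) {f : X → ℝ} (hf : Measurable f) :
    ∫ y, f y ∂(empMeas n x : Measure X) = (n : ℝ)⁻¹ * ∑ i, f (x i) := by
  have hf' := hf.stronglyMeasurable
  have : (empMeas n x : Measure X) = (n : ℝ≥0∞)⁻¹ • ∑ i, Measure.dirac (x i) :=
    congrArg Subtype.val (dif_pos hn)
  rw [this, integral_smul_measure, integral_finsetSum_measure]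
  · simp [integral_dirac' _ _ hf']
  · intro i _
    exact integrable_dirac' hf' (by simp)

lemma mmd_empMeas {X : Type*} [MeasurableSpace X] [Nonempty X] {k : X → X → ℝ}
    (hk_meas : Measurable fun p : X × X => k p.1 p.2) (hk_symm : ∀ x y, k x y = k y x)
    {m n : ℕ} (hm : 0 < m) (hn : 0 < n) (y : Fin m → X) (x : Fin n → X) :
    mmd k (empMeas m y : Measure X) (empMeas n x : Measure X) =
      kernelNorm k (Sum.elim (fun _ : Fin m => (m : ℝ)⁻¹) fun _ : Fin n => -(n : ℝ)⁻¹)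
        (Sum.elim y x) := by
  have hk1 (a : X) : Measurable (k a) := hk_meas.of_uncurry_left
  have hk2 (a : X) : Measurable fun b => k b a := hk_meas.of_uncurry_right
  have hdouble {m n : ℕ} (hm : 0 < m) (hn : 0 < n) (y : Fin m → X) (x : Fin n → X) :
      ∫ a, ∫ b, k a b ∂(empMeas n x : Measure X) ∂(empMeas m y : Measure X) =
        ∑ i, ∑ j, (m : ℝ)⁻¹ * (n : ℝ)⁻¹ * k (y i) (x j) := by
    simp_rw [integral_empMeas hn x (hk1 _)]
    rw [integral_empMeas hm y
      (Measurable.const_mul (Finset.measurable_sum _ fun j _ => hk2 (x j)) _)]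
    simp_rw [Finset.mul_sum, mul_assoc]
  have hcross : ∑ j : Fin n, ∑ i : Fin m, (n : ℝ)⁻¹ * (m : ℝ)⁻¹ * k (x j) (y i) =
      ∑ i : Fin m, ∑ j : Fin n, (m : ℝ)⁻¹ * (n : ℝ)⁻¹ * k (y i) (x j) := by
    rw [Finset.sum_comm]
    simp only [hk_symm, mul_comm]
  rw [mmd, mmdSq, kernelNorm, hdouble hm hm, hdouble hn hn, hdouble hm hn]
  congr 1
  simp only [Fintype.sum_sum_type, Sum.elim_inl, Sum.elim_inr, mul_neg, neg_mul,
    Finset.sum_neg_distrib, Finset.sum_add_distrib, hcross]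
  ring

/-- Two-sample concentration of the MMD under the null: if `y_1,…,y_m` and `x_1,…,x_n` are all
i.i.d. with law `P` (the samples independent), and `k` is a bounded measurable symmetric
positive semidefinite kernel with `0 ≤ k ≤ K`, then
`Prob(d_k(P̂_m, Q̂_n) > 2 sqrt(K/m) + 2 sqrt(K/n) + ε) ≤ 2 exp(-ε²mn/(2K(m+n)))`. -/
theorem mmd_two_sample_concentration {X : Type*} [MeasurableSpace X] [TopologicalSpace X]
    [PolishSpace X] [BorelSpace X] [Nonempty X]
    (k : X → X → ℝ) (hk_meas : Measurable fun p : X × X => k p.1 p.2)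
    (hk_symm : ∀ x y, k x y = k y x)
    (hk_psd : ∀ (N : ℕ) (z : Fin N → X) (c : Fin N → ℝ),
      0 ≤ ∑ i, ∑ j, c i * c j * k (z i) (z j))
    (K : ℝ) (hk_bdd : ∀ x y, k x y ∈ Set.Icc (0 : ℝ) K)
    (P : Measure X) [IsProbabilityMeasure P]
    (m n : ℕ) (hm : 0 < m) (hn : 0 < n) (ε : ℝ) (hε : 0 < ε) :
    (Measure.pi (fun _ : Fin m => P)).prod (Measure.pi (fun _ : Fin n => P))
        {p : (Fin m → X) × (Fin n → X) |
          2 * Real.sqrt (K / m) + 2 * Real.sqrt (K / n) + ε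
            < mmd k (empMeas m p.1 : Measure X) (empMeas n p.2 : Measure X)}
      ≤ ENNReal.ofReal (2 * Real.exp (-(ε ^ 2 * m * n) / (2 * K * (m + n)))) := by
  have hm' : (0 : ℝ) < m := by exact_mod_cast hm
  have hn' : (0 : ℝ) < n := by exact_mod_cast hn
  have hK : 0 ≤ K := (hk_bdd (Classical.arbitrary X) (Classical.arbitrary X)).1.trans
    (hk_bdd (Classical.arbitrary X) (Classical.arbitrary X)).2
  set w : Fin m ⊕ Fin n → ℝ := Sum.elim (fun _ => (m : ℝ)⁻¹) fun _ => -(n : ℝ)⁻¹ with hw_def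
  have hw : ∑ i, w i = 0 := by simp [hw_def, hm'.ne', hn'.ne']
  have hw2 : ∑ i, w i ^ 2 = 1 / m + 1 / n := by
    simp [hw_def]
    field_simp
  have htail := measureReal_kernelNorm_ge_le hk_meas hk_symm hk_psd hk_bdd hK P w hw hε.le
  have hpres := measurePreserving_sumPiEquivProdPi_symm (fun _ : Fin m ⊕ Fin n => P)
  have hsqrt : √(K * ∑ i, w i ^ 2) ≤ 2 * √(K / m) + 2 * √(K / n) := by
    have h1 : √(K * ∑ i, w i ^ 2) ≤ √(K / m) + √(K / n) := by
      rw [hw2, mul_add, mul_one_div, mul_one_div]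
      refine Real.sqrt_le_iff.2 ⟨by positivity, ?_⟩
      nlinarith [Real.sq_sqrt (by positivity : 0 ≤ K / m), Real.sq_sqrt (by positivity : 0 ≤ K / n),
        mul_nonneg (Real.sqrt_nonneg (K / m)) (Real.sqrt_nonneg (K / n))]
    linarith [Real.sqrt_nonneg (K / m), Real.sqrt_nonneg (K / n)]
  have hexp : -ε ^ 2 / (K * ∑ i, w i ^ 2) ≤ -(ε ^ 2 * m * n) / (2 * K * (m + n)) := by
    rcases hK.eq_or_lt with rfl | hK'
    · simp
    · rw [hw2, neg_div, neg_div, neg_le_neg_iff]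
      have : ε ^ 2 / (K * (1 / m + 1 / n)) = ε ^ 2 * m * n / (K * (m + n)) := by
        field_simp
        ring
      rw [this]
      gcongr
      nlinarith
  calc _ ≤ (Measure.pi fun _ : Fin m ⊕ Fin n => P)
          {z | √(K * ∑ i, w i ^ 2) + ε ≤ kernelNorm k w z} := by
        rw [← hpres.measure_preimage_equiv]
        refine measure_mono fun p hp => ?_
        have hp' : 2 * √(K / m) + 2 * √(K / n) + ε <
          mmd k (empMeas m p.1 : Measure X) (empMeas n p.2 : Measure X) := hp
        rw [mmd_empMeas hk_meas hk_symm hm hn] at hp'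
        have hz : (MeasurableEquiv.sumPiEquivProdPi fun _ : Fin m ⊕ Fin n => X).symm p =
            Sum.elim p.1 p.2 := by
          funext i
          cases i <;> rfl
        simp only [Set.mem_preimage, Set.mem_ofPred_eq, hz]
        linarith
    _ ≤ ENNReal.ofReal (Real.exp (-ε ^ 2 / (K * ∑ i, w i ^ 2))) := by
        rw [← ofReal_measureReal]
        exact ENNReal.ofReal_le_ofReal htail
    _ ≤ _ := by
        refine ENNReal.ofReal_le_ofReal ((Real.exp_le_exp.2 hexp).trans ?_)
        linarith [Real.exp_pos (-(ε ^ 2 * m * n) / (2 * K * (m + n)))]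
end
end

section
/- (Extended Sanov's theorem, finite alphabet.) Let X = {1, …, t} be a finite set, P and Q probability distributions on X, and let y_1, y_2, … be i.i.d. with law P and, independently, x_1, x_2, … i.i.d. with law Q. Let (m_k, n_k) be a sequence with m_k, n_k → ∞ and m_k/(m_k + n_k) → c ∈ (0,1). Then for every set Γ of pairs of probability distributions on X: limsup_{k→∞} −(1/(m_k+n_k)) log Prob((P̂_{m_k}, Q̂_{n_k}) ∈ Γ) ≤ inf_{(R,S) ∈ int Γ} [ c·D(R‖P) + (1−c)·D(S‖Q) ], and liminf_{k→∞} −(1/(m_k+n_k)) log Prob((P̂_{m_k}, Q̂_{n_k}) ∈ Γ) ≥ inf_{(R,S) ∈ cl Γ} [ c·D(R‖P) + (1−c)·D(S‖Q) ], where int Γ and cl Γ are the interior and closure of Γ in the product topology on the product of two copies of the probability simplex over X. -/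
open MeasureTheory Filter Topology ENNReal
open scoped Classical

noncomputable section
/-- Kullback-Leibler divergence between distributions on a finite alphabet given as vectors,
with the conventions `0·log 0 = 0·log(0/0) = 0` and `a·log(a/0) = +∞` for `a > 0`. -/
def finKL {t : ℕ} (p q : Fin t → ℝ) : ℝ≥0∞ :=
  if ∀ i, q i = 0 → p i = 0 then ENNReal.ofReal (∑ i, p i * Real.log (p i / q i)) else ⊤

/-- The measure on the finite alphabet `Fin t` with mass function `p`. -/
def discMeasure {t : ℕ} (p : Fin t → ℝ) : Measure (Fin t) :=
  ∑ i, ENNReal.ofReal (p i) • Measure.dirac i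

instance {t : ℕ} (p : Fin t → ℝ) : IsFiniteMeasure (discMeasure p) := by
  constructor
  unfold discMeasure
  simp only [Measure.coe_finset_sum, Finset.sum_apply, Measure.smul_apply, smul_eq_mul,
    measure_univ, mul_one]
  exact ENNReal.sum_lt_top.mpr fun i _ => ENNReal.ofReal_lt_top

/-- The empirical distribution of a sample from a finite alphabet, as a mass function. -/
def empDist {t m : ℕ} (x : Fin m → Fin t) : Fin t → ℝ :=
  fun i => ((Finset.univ.filter fun j => x j = i).card : ℝ) / m

lemma empDist_mem {t m : ℕ} (hm : 0 < m) (x : Fin m → Fin t) :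
    empDist x ∈ stdSimplex ℝ (Fin t) := by
  constructor
  · intro i
    exact div_nonneg (by positivity) (by positivity)
  · unfold empDist
    rw [← Finset.sum_div, div_eq_one_iff_eq (by exact_mod_cast hm.ne')]
    rw [← Nat.cast_sum]
    norm_cast
    rw [← Finset.card_eq_sum_card_fiberwise (fun j _ => Finset.mem_univ (x j))]
    simp

/-- A default element of the probability simplex over a nonempty finite alphabet. -/
def simplexDefault {t : ℕ} (ht : 0 < t) : stdSimplex ℝ (Fin t) :=
  ⟨fun i => if i = (⟨0, ht⟩ : Fin t) then 1 else 0, by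
    constructor
    · intro i; dsimp only; split <;> norm_num
    · simp⟩

/-- The empirical distribution of a sample from a finite alphabet, as an element of the
probability simplex (junk value for `m = 0`). -/
def empDistS {t m : ℕ} (ht : 0 < t) (x : Fin m → Fin t) : stdSimplex ℝ (Fin t) :=
  if h : 0 < m then ⟨empDist x, empDist_mem h x⟩ else simplexDefault ht
/-- The exponential decay rate `-(1/n) log p` of a probability `p`, valued in `EReal`
(with `-(1/n) log 0 = ⊤`). -/
def expRate (n : ℕ) (p : ℝ≥0∞) : EReal := -((((n : ℝ)⁻¹ : ℝ) : EReal) * ENNReal.log p)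

lemma discMeasure_singleton {t : ℕ} (p : Fin t → ℝ) (i : Fin t) :
    discMeasure p {i} = ENNReal.ofReal (p i) := by
  simp [discMeasure, Finset.sum_apply,
    Set.indicator_apply]

lemma isProbabilityMeasure_discMeasure {t : ℕ} (p : stdSimplex ℝ (Fin t)) :
    IsProbabilityMeasure (discMeasure p.1) := by
  constructor
  simp only [discMeasure, Measure.coe_finsetSum, Finset.sum_apply, Measure.smul_apply,
    smul_eq_mul, measure_univ, mul_one]
  rw [← ENNReal.ofReal_sum_of_nonneg fun i _ => p.2.1 i, p.2.2, ENNReal.ofReal_one]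

lemma pi_discMeasure_singleton {t m : ℕ} {p : Fin t → ℝ} (hp : ∀ i, 0 ≤ p i)
    (y : Fin m → Fin t) :
    Measure.pi (fun _ : Fin m => discMeasure p) {y} = ENNReal.ofReal (∏ j, p (y j)) := by
  rw [Measure.pi_singleton, ENNReal.ofReal_prod_of_nonneg fun j _ => hp _]
  simp [discMeasure_singleton]

lemma measure_le_mul_of_singleton {α : Type*} [Finite α] [MeasurableSpace α]
    [MeasurableSingletonClass α] (μ ν : Measure α) (C : ℝ≥0∞) (A : Set α)
    (h : ∀ y ∈ A, μ {y} ≤ C * ν {y}) : μ A ≤ C * ν A := by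
  have hA := A.toFinite
  rw [← hA.coe_toFinset, ← sum_measure_singleton, ← sum_measure_singleton, Finset.mul_sum]
  exact Finset.sum_le_sum fun y hy => h y (hA.mem_toFinset.1 hy)

lemma empDistS_apply {t m : ℕ} (ht : 0 < t) (hm : 0 < m) (y : Fin m → Fin t) (i : Fin t) :
    (empDistS ht y).1 i = ((Finset.univ.filter fun j => y j = i).card : ℝ) / m := by
  simp [empDistS, hm, empDist]

lemma sum_comp_eq_mul_sum_empDistS {t m : ℕ} (ht : 0 < t) (hm : 0 < m) (y : Fin m → Fin t)
    (f : Fin t → ℝ) : ∑ j, f (y j) = m * ∑ i, (empDistS ht y).1 i * f i := by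
  have hm' : (m : ℝ) ≠ 0 := by positivity
  rw [← Finset.sum_fiberwise (s := Finset.univ) (g := y), Finset.mul_sum]
  refine Finset.sum_congr rfl fun i _ => ?_
  rw [empDistS_apply ht hm, Finset.sum_congr rfl (g := fun _ => f i)
    (fun j hj => by rw [(Finset.mem_filter.1 hj).2])]
  rw [Finset.sum_const, nsmul_eq_mul]
  field_simp

lemma empDistS_pos {t m : ℕ} (ht : 0 < t) (hm : 0 < m) (y : Fin m → Fin t) (j : Fin m) :
    0 < (empDistS ht y).1 (y j) := by
  rw [empDistS_apply ht hm]
  have : 0 < (Finset.univ.filter fun k => y k = y j).card :=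
    Finset.card_pos.2 ⟨j, by simp⟩
  positivity

/-- The real-valued relative entropy sum, meaningful when `r` is absolutely continuous with
respect to `p`. -/
def klSum {t : ℕ} (r p : Fin t → ℝ) : ℝ := ∑ i, r i * Real.log (r i / p i)

lemma klSum_nonneg {t : ℕ} (r p : stdSimplex ℝ (Fin t)) (h : ∀ i, p.1 i = 0 → r.1 i = 0) :
    0 ≤ klSum r.1 p.1 := by
  have key : ∀ i, r.1 i - p.1 i ≤ r.1 i * Real.log (r.1 i / p.1 i) := by
    intro i
    rcases (r.2.1 i).eq_or_lt with hr | hr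
    · rw [← hr]
      simpa using p.2.1 i
    · have hp : 0 < p.1 i := (p.2.1 i).lt_of_ne fun h0 => hr.ne' (h i h0.symm)
      have := Real.one_sub_inv_le_log_of_pos (div_pos hr hp)
      calc r.1 i - p.1 i = r.1 i * (1 - (r.1 i / p.1 i)⁻¹) := by field_simp
        _ ≤ _ := by gcongr
  have := Finset.sum_le_sum fun i (_ : i ∈ Finset.univ) => key i
  rwa [Finset.sum_sub_distrib, r.2.2, p.2.2, sub_self] at this

lemma finKL_of_ac {t : ℕ} {r p : Fin t → ℝ} (h : ∀ i, p i = 0 → r i = 0) :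
    finKL r p = ENNReal.ofReal (klSum r p) := if_pos h

lemma finKL_of_not_ac {t : ℕ} {r p : Fin t → ℝ} (h : ¬ ∀ i, p i = 0 → r i = 0) :
    finKL r p = ⊤ := if_neg h

lemma mul_exp_neg_log_div {a b : ℝ} (ha : 0 < a) (hb : 0 < b) :
    a * Real.exp (-Real.log (a / b)) = b := by
  rw [Real.exp_neg, Real.exp_log (div_pos ha hb)]
  field_simp

lemma prod_mul_exp_neg {t m : ℕ} (ht : 0 < t) (hm : 0 < m) (y : Fin m → Fin t)
    (r f : Fin t → ℝ) :
    ∏ j, (r (y j) * Real.exp (-f (y j)))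
      = Real.exp (-(m * ∑ i, (empDistS ht y).1 i * f i)) * ∏ j, r (y j) := by
  rw [Finset.prod_mul_distrib, ← Real.exp_sum, Finset.sum_neg_distrib,
    sum_comp_eq_mul_sum_empDistS ht hm, mul_comm]

lemma pi_empDistS_eq_le {t m : ℕ} (ht : 0 < t) (hm : 0 < m) (p r : stdSimplex ℝ (Fin t))
    (hac : ∀ i, p.1 i = 0 → r.1 i = 0) :
    Measure.pi (fun _ : Fin m => discMeasure p.1) {y | empDistS ht y = r}
      ≤ ENNReal.ofReal (Real.exp (-(m * klSum r.1 p.1))) := by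
  have := isProbabilityMeasure_discMeasure r
  calc _ ≤ ENNReal.ofReal (Real.exp (-(m * klSum r.1 p.1))) *
        Measure.pi (fun _ : Fin m => discMeasure r.1) {y | empDistS ht y = r} := by
        refine measure_le_mul_of_singleton _ _ _ _ fun y hy => ?_
        rw [pi_discMeasure_singleton p.2.1, pi_discMeasure_singleton r.2.1,
          ← ENNReal.ofReal_mul (Real.exp_nonneg _)]
        apply ENNReal.ofReal_le_ofReal
        have hy' : empDistS ht y = r := hy
        have h2 := prod_mul_exp_neg ht hm y r.1 fun i => Real.log (r.1 i / p.1 i)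
        rw [hy'] at h2
        rw [klSum, ← h2]
        refine (Finset.prod_congr rfl fun j _ => ?_).le
        have hr : 0 < r.1 (y j) := hy' ▸ empDistS_pos ht hm y j
        exact (mul_exp_neg_log_div hr
          ((p.2.1 _).lt_of_ne fun h0 => hr.ne' (hac _ h0.symm))).symm
    _ ≤ _ := mul_le_of_le_one_right' prob_le_one

lemma pi_empDistS_eq_zero {t m : ℕ} (ht : 0 < t) (hm : 0 < m) (p r : stdSimplex ℝ (Fin t))
    (hac : ¬ ∀ i, p.1 i = 0 → r.1 i = 0) :
    Measure.pi (fun _ : Fin m => discMeasure p.1) {y | empDistS ht y = r} = 0 := by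
  push Not at hac
  obtain ⟨i, hpi, hri⟩ := hac
  refine le_antisymm ?_ zero_le
  rw [← zero_mul (Measure.pi (fun _ : Fin m => discMeasure p.1) {y | empDistS ht y = r})]
  refine measure_le_mul_of_singleton _ _ _ _ fun y hy => ?_
  have hy' : empDistS ht y = r := hy
  obtain ⟨j, hj⟩ : ∃ j, y j = i := by
    by_contra! hne
    apply hri
    rw [← hy', empDistS_apply ht hm]
    simp [hne]
  rw [pi_discMeasure_singleton p.2.1, Finset.prod_eq_zero (Finset.mem_univ j) (by rw [hj, hpi])]
  simp

lemma le_pi_empDistS_mem {t m : ℕ} (ht : 0 < t) (hm : 0 < m) (p r : stdSimplex ℝ (Fin t))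
    (hac : ∀ i, p.1 i = 0 → r.1 i = 0) {a : ℝ} {U : Set (stdSimplex ℝ (Fin t))}
    (hU : ∀ s ∈ U, ∑ i, s.1 i * Real.log (r.1 i / p.1 i) ≤ a) :
    Measure.pi (fun _ : Fin m => discMeasure r.1) {y | empDistS ht y ∈ U}
      ≤ ENNReal.ofReal (Real.exp (m * a)) *
        Measure.pi (fun _ : Fin m => discMeasure p.1) {y | empDistS ht y ∈ U} := by
  refine measure_le_mul_of_singleton _ _ _ _ fun y hy => ?_
  rw [pi_discMeasure_singleton p.2.1, pi_discMeasure_singleton r.2.1,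
    ← ENNReal.ofReal_mul (Real.exp_nonneg _)]
  apply ENNReal.ofReal_le_ofReal
  have h2 := prod_mul_exp_neg ht hm y r.1 fun i => Real.log (r.1 i / p.1 i)
  have h3 : ∏ j, (r.1 (y j) * Real.exp (-Real.log (r.1 (y j) / p.1 (y j)))) ≤ ∏ j, p.1 (y j) := by
    refine Finset.prod_le_prod (fun j _ => mul_nonneg (r.2.1 _) (Real.exp_nonneg _)) fun j _ => ?_
    rcases (r.2.1 (y j)).eq_or_lt with hr | hr
    · rw [← hr, zero_mul]
      exact p.2.1 _
    · exact (mul_exp_neg_log_div hr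
        ((p.2.1 _).lt_of_ne fun h0 => hr.ne' (hac _ h0.symm))).le
  rw [h2] at h3
  have h4 : 0 ≤ ∏ j, r.1 (y j) := Finset.prod_nonneg fun j _ => r.2.1 _
  calc ∏ j, r.1 (y j) = Real.exp (m * a) * (Real.exp (-(m * a)) * ∏ j, r.1 (y j)) := by
        rw [← mul_assoc, ← Real.exp_add]
        simp
    _ ≤ Real.exp (m * a) * ∏ j, p.1 (y j) := by
        gcongr
        refine le_trans ?_ h3
        gcongr
        exact hU _ hy

lemma pi_abs_empDistS_sub_ge_le {t m : ℕ} (ht : 0 < t) (hm : 0 < m)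
    (r : stdSimplex ℝ (Fin t)) (i : Fin t) {ε : ℝ} (hε : 0 < ε) :
    Measure.pi (fun _ : Fin m => discMeasure r.1) {y | ε ≤ |(empDistS ht y).1 i - r.1 i|}
      ≤ ENNReal.ofReal (1 / (m * ε ^ 2)) := by
  have := isProbabilityMeasure_discMeasure r
  have hm' : (0 : ℝ) < m := by positivity
  set μ := Measure.pi (fun _ : Fin m => discMeasure r.1)
  let X : Fin t → ℝ := fun a => if a = i then 1 else 0
  have hXi : ∀ q : Measure (Fin t), IsFiniteMeasure q → MemLp X 2 q := fun q _ =>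
    MemLp.of_bound (by fun_prop) 1 (by
      filter_upwards with a
      simp only [X]
      split_ifs <;> simp)
  have hS : ∀ y : Fin m → Fin t, (∑ j, fun ω : Fin m → Fin t => X (ω j)) y
      = m * (empDistS ht y).1 i := by
    intro y
    rw [Finset.sum_apply, sum_comp_eq_mul_sum_empDistS ht hm y X]
    simp [X]
  have hX1 : ∫ a, X a ∂discMeasure r.1 = r.1 i := by
    rw [integral_fintype (Integrable.of_finite)]
    simp [X, Measure.real, discMeasure_singleton, ENNReal.toReal_ofReal (r.2.1 i)]
  have hS2 : MemLp (∑ j, fun ω : Fin m → Fin t => X (ω j)) 2 μ :=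
    memLp_finsetSum' _ fun j _ =>
      (hXi _ inferInstance).comp_measurePreserving (measurePreserving_eval _ j)
  have hmean : ∫ ω, (∑ j, fun ω : Fin m → Fin t => X (ω j)) ω ∂μ = m * r.1 i := by
    simp only [Finset.sum_apply]
    rw [integral_finsetSum _ fun j _ => Integrable.of_finite]
    simp only [μ]
    rw [Finset.sum_congr rfl fun j _ => integral_comp_eval
      (μ := fun _ : Fin m => discMeasure r.1) (i := j) (f := X) (by fun_prop)]
    simp [hX1]
  have hvar : ProbabilityTheory.variance (∑ j, fun ω : Fin m → Fin t => X (ω j)) μ ≤ m := by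
    simp only [μ]
    rw [ProbabilityTheory.variance_sum_pi (X := fun _ => X) fun _ => hXi _ inferInstance]
    have h1 : ProbabilityTheory.variance X (discMeasure r.1) ≤ ((1 - 0) / 2) ^ 2 :=
      ProbabilityTheory.variance_le_sq_of_bounded (by
        filter_upwards with a
        simp only [X]
        split_ifs <;> simp) (by fun_prop)
    simp only [Finset.sum_const, Finset.card_univ, Fintype.card_fin, nsmul_eq_mul]
    nlinarith
  have hcheb := ProbabilityTheory.meas_ge_le_variance_div_sq hS2 (mul_pos hm' hε)
  calc μ {y | ε ≤ |(empDistS ht y).1 i - r.1 i|} ≤ _ := by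
        refine measure_mono fun y hy => ?_
        have hy' : ε ≤ |(empDistS ht y).1 i - r.1 i| := hy
        change m * ε ≤ |_ - _|
        rw [hmean, hS, ← mul_sub, abs_mul, abs_of_pos hm']
        gcongr
    _ ≤ _ := hcheb
    _ ≤ _ := by
        apply ENNReal.ofReal_le_ofReal
        calc _ ≤ (m : ℝ) / (m * ε) ^ 2 := by gcongr
          _ = _ := by field_simp

lemma eventually_half_le_pi_empDistS_mem {t : ℕ} (ht : 0 < t) (r : stdSimplex ℝ (Fin t))
    {U : Set (stdSimplex ℝ (Fin t))} (hU : U ∈ 𝓝 r) :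
    ∀ᶠ m : ℕ in atTop,
      ENNReal.ofReal (1 / 2) ≤
        Measure.pi (fun _ : Fin m => discMeasure r.1) {y | empDistS ht y ∈ U} := by
  have := isProbabilityMeasure_discMeasure r
  obtain ⟨ε, hε, hεU⟩ := Metric.mem_nhds_iff.1 hU
  have hlim : Tendsto (fun m : ℕ => (t / ε ^ 2 : ℝ) / m) atTop (𝓝 0) :=
    tendsto_const_div_atTop_nhds_zero_nat _
  filter_upwards [hlim.eventually_le_const (by norm_num : (0 : ℝ) < 1 / 2), eventually_gt_atTop 0]
    with m hm2 hm
  set μ := Measure.pi (fun _ : Fin m => discMeasure r.1)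
  have hcompl : μ {y | empDistS ht y ∈ U}ᶜ ≤ ENNReal.ofReal (1 / 2) := by
    calc μ {y | empDistS ht y ∈ U}ᶜ
        ≤ μ (⋃ i, {y | ε ≤ |(empDistS ht y).1 i - r.1 i|}) := by
          refine measure_mono fun y hy => ?_
          by_contra hcon
          simp only [Set.mem_iUnion, Set.mem_ofPred_eq, not_exists, not_le] at hcon
          refine hy (hεU ?_)
          rw [Metric.mem_ball, Subtype.dist_eq, dist_pi_lt_iff hε]
          exact fun i => by rw [Real.dist_eq]; exact hcon i
      _ ≤ ∑ i, μ {y | ε ≤ |(empDistS ht y).1 i - r.1 i|} := measure_iUnion_fintype_le _ _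
      _ ≤ ∑ _i : Fin t, ENNReal.ofReal (1 / (m * ε ^ 2)) :=
          Finset.sum_le_sum fun i _ => pi_abs_empDistS_sub_ge_le ht hm r i hε
      _ = ENNReal.ofReal ((t / ε ^ 2 : ℝ) / m) := by
          rw [← ENNReal.ofReal_sum_of_nonneg fun _ _ => by positivity]
          congr 1
          simp
          field_simp
      _ ≤ _ := ENNReal.ofReal_le_ofReal hm2
  have hmeas : MeasurableSet {y : Fin m → Fin t | empDistS ht y ∈ U} :=
    (Set.toFinite _).measurableSet
  rw [← compl_compl {y : Fin m → Fin t | empDistS ht y ∈ U},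
    prob_compl_eq_one_sub hmeas.compl]
  refine le_trans ?_ (tsub_le_tsub_left hcompl 1)
  rw [← ENNReal.ofReal_one, ← ENNReal.ofReal_sub _ (by norm_num)]
  norm_num

lemma expRate_ofReal_exp {N : ℕ} (hN : 0 < N) (a : ℝ) :
    expRate N (ENNReal.ofReal (Real.exp (-(N * a)))) = a := by
  have hN' : (N : ℝ) ≠ 0 := by positivity
  rw [expRate, ENNReal.log_ofReal_of_pos (Real.exp_pos _), Real.log_exp]
  norm_cast
  field_simp

lemma expRate_antitone (N : ℕ) : Antitone (expRate N) := fun _ _ h =>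
  EReal.neg_le_neg_iff.2 <| mul_le_mul_of_nonneg_left (ENNReal.log_le_log h) <|
    EReal.coe_nonneg.2 (by positivity)

lemma expRate_le {N : ℕ} (hN : 0 < N) {a : ℝ} {P : ℝ≥0∞}
    (h : ENNReal.ofReal (Real.exp (-(N * a))) ≤ P) : expRate N P ≤ a :=
  (expRate_antitone N h).trans_eq (expRate_ofReal_exp hN a)

lemma le_expRate {N : ℕ} (hN : 0 < N) {a : ℝ} {P : ℝ≥0∞}
    (h : P ≤ ENNReal.ofReal (Real.exp (-(N * a)))) : a ≤ expRate N P :=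
  (expRate_ofReal_exp hN a).symm.trans_le (expRate_antitone N h)

lemma card_image_empDistS_le {t m : ℕ} (ht : 0 < t) (hm : 0 < m) :
    (Finset.univ.image fun y : Fin m → Fin t => empDistS ht y).card ≤ (m + 1) ^ t := by
  let g : (Fin t → Fin (m + 1)) → stdSimplex ℝ (Fin t) := fun k =>
    if h : (fun i => ((k i : ℕ) : ℝ) / m) ∈ stdSimplex ℝ (Fin t) then ⟨_, h⟩
    else simplexDefault ht
  have hsub : (Finset.univ.image fun y : Fin m → Fin t => empDistS ht y)
      ⊆ Finset.univ.image g := by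
    intro s hs
    obtain ⟨y, -, rfl⟩ := Finset.mem_image.1 hs
    refine Finset.mem_image.2 ⟨fun i => ⟨(Finset.univ.filter fun j => y j = i).card,
      Nat.lt_succ_of_le ((Finset.card_le_univ _).trans_eq (Fintype.card_fin m))⟩,
      Finset.mem_univ _, ?_⟩
    simp only [g, empDistS, hm, dif_pos]
    exact dif_pos (empDist_mem hm y)
  calc _ ≤ (Finset.univ.image g).card := Finset.card_le_card hsub
    _ ≤ Fintype.card (Fin t → Fin (m + 1)) := Finset.card_image_le
    _ = (m + 1) ^ t := by simp

lemma prod_pi_empDistS_mem_le {t m n : ℕ} (ht : 0 < t) (hm : 0 < m) (hn : 0 < n)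
    (p q : Fin t → ℝ) (Γ : Set (stdSimplex ℝ (Fin t) × stdSimplex ℝ (Fin t))) (C : ℝ≥0∞)
    (hC : ∀ rs ∈ Γ, Measure.pi (fun _ : Fin m => discMeasure p) {y | empDistS ht y = rs.1} *
      Measure.pi (fun _ : Fin n => discMeasure q) {x | empDistS ht x = rs.2} ≤ C) :
    (Measure.pi (fun _ : Fin m => discMeasure p)).prod
        (Measure.pi (fun _ : Fin n => discMeasure q))
        {yx : (Fin m → Fin t) × (Fin n → Fin t) | (empDistS ht yx.1, empDistS ht yx.2) ∈ Γ}
      ≤ ((m + 1) ^ t * (n + 1) ^ t : ℕ) * C := by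
  set μ := Measure.pi (fun _ : Fin m => discMeasure p)
  set ν := Measure.pi (fun _ : Fin n => discMeasure q)
  let T := (Finset.univ.image fun y : Fin m → Fin t => empDistS ht y) ×ˢ
    (Finset.univ.image fun x : Fin n → Fin t => empDistS ht x)
  have hT : (T.filter (· ∈ Γ)).card ≤ (m + 1) ^ t * (n + 1) ^ t := by
    refine (Finset.card_filter_le _ _).trans ?_
    rw [Finset.card_product]
    exact Nat.mul_le_mul (card_image_empDistS_le ht hm) (card_image_empDistS_le ht hn)
  calc _ ≤ μ.prod ν (⋃ rs ∈ T.filter (· ∈ Γ),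
        {y | empDistS ht y = rs.1} ×ˢ {x | empDistS ht x = rs.2}) := by
        refine measure_mono fun yx hyx => ?_
        refine Set.mem_biUnion (x := (empDistS ht yx.1, empDistS ht yx.2)) ?_ ⟨rfl, rfl⟩
        exact Finset.mem_coe.2 (Finset.mem_filter.2 ⟨by simp [T], hyx⟩)
    _ ≤ ∑ rs ∈ T.filter (· ∈ Γ), μ.prod ν
        ({y | empDistS ht y = rs.1} ×ˢ {x | empDistS ht x = rs.2}) :=
        measure_biUnion_finset_le _ _
    _ ≤ ∑ _rs ∈ T.filter (· ∈ Γ), C := Finset.sum_le_sum fun rs hrs => by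
        rw [Measure.prod_prod]
        exact hC rs (Finset.mem_filter.1 hrs).2
    _ ≤ _ := by
        rw [Finset.sum_const, nsmul_eq_mul]
        gcongr

lemma pi_empDistS_eq_mul_le {t m n : ℕ} (ht : 0 < t) (hm : 0 < m) (hn : 0 < n)
    (p q r s : stdSimplex ℝ (Fin t)) {c b M ρ : ℝ} (hc0 : 0 ≤ c) (hc1 : c ≤ 1)
    (hM : 0 ≤ M) (hρ : 0 ≤ ρ) (hmρ : M * ρ * c ≤ m) (hnρ : M * ρ * (1 - c) ≤ n)
    (hb : (b : EReal) ≤ ((ENNReal.ofReal c * finKL r.1 p.1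
            + ENNReal.ofReal (1 - c) * finKL s.1 q.1 : ℝ≥0∞) : EReal)) :
    Measure.pi (fun _ : Fin m => discMeasure p.1) {y | empDistS ht y = r} *
      Measure.pi (fun _ : Fin n => discMeasure q.1) {x | empDistS ht x = s}
      ≤ ENNReal.ofReal (Real.exp (-(M * (ρ * b)))) := by
  by_cases hr : ∀ i, p.1 i = 0 → r.1 i = 0
  swap
  · simp [pi_empDistS_eq_zero ht hm p r hr]
  by_cases hs : ∀ i, q.1 i = 0 → s.1 i = 0
  swap
  · simp [pi_empDistS_eq_zero ht hn q s hs]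
  refine (mul_le_mul' (pi_empDistS_eq_le ht hm p r hr) (pi_empDistS_eq_le ht hn q s hs)).trans ?_
  rw [← ENNReal.ofReal_mul (Real.exp_nonneg _), ← Real.exp_add]
  apply ENNReal.ofReal_le_ofReal
  rw [Real.exp_le_exp]
  have hx := klSum_nonneg r p hr
  have hy := klSum_nonneg s q hs
  rw [finKL_of_ac hr, finKL_of_ac hs, ← ENNReal.ofReal_mul hc0,
    ← ENNReal.ofReal_mul (by linarith), ← ENNReal.ofReal_add (by positivity)
      (mul_nonneg (by linarith) hy), EReal.coe_ennreal_ofReal, EReal.coe_le_coe_iff,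
    max_eq_left (add_nonneg (by positivity) (mul_nonneg (by linarith) hy))] at hb
  have h1 := mul_le_mul_of_nonneg_right hmρ hx
  have h2 := mul_le_mul_of_nonneg_right hnρ hy
  have h3 := mul_le_mul_of_nonneg_left hb (mul_nonneg hM hρ)
  linarith

lemma tendsto_log_succ_div_atTop :
    Tendsto (fun N : ℕ => Real.log (N + 1) / N) atTop (𝓝 0) := by
  have h := Real.tendsto_pow_log_div_mul_add_atTop 1 (-1) 1 one_ne_zero
  have h2 : Tendsto (fun N : ℕ => (N : ℝ) + 1) atTop atTop :=
    tendsto_atTop_add_const_right _ _ tendsto_natCast_atTop_atTop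
  refine (h.comp h2).congr fun N => ?_
  simp

lemma mul_ofReal_exp_le_ofReal_exp {t m n : ℕ} (h : 0 < m + n) (a : ℝ) :
    (((m + 1) ^ t * (n + 1) ^ t : ℕ) : ℝ≥0∞) *
        ENNReal.ofReal (Real.exp (-(((m + n : ℕ) : ℝ) * a)))
      ≤ ENNReal.ofReal (Real.exp (-(((m + n : ℕ) : ℝ) *
          (a - 2 * t * (Real.log ((m + n : ℕ) + 1) / (m + n : ℕ)))))) := by
  have hN : ((m + n : ℕ) : ℝ) ≠ 0 := by positivity
  rw [← ENNReal.ofReal_natCast, ← ENNReal.ofReal_mul (by positivity)]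
  apply ENNReal.ofReal_le_ofReal
  have h1 : -(((m + n : ℕ) : ℝ) * (a - 2 * t * (Real.log ((m + n : ℕ) + 1) / (m + n : ℕ))))
      = ((2 * t : ℕ) : ℝ) * Real.log ((m + n : ℕ) + 1) + -(((m + n : ℕ) : ℝ) * a) := by
    push_cast at hN ⊢
    field_simp
    ring
  rw [h1, Real.exp_add, Real.exp_nat_mul, Real.exp_log (by positivity)]
  gcongr
  rw [two_mul, pow_add]
  push_cast
  gcongr <;> linarith [(Nat.cast_nonneg m : (0 : ℝ) ≤ m), (Nat.cast_nonneg n : (0 : ℝ) ≤ n)]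

lemma eventually_le_pi_empDistS_mem {t : ℕ} (ht : 0 < t) (p r : stdSimplex ℝ (Fin t))
    (hac : ∀ i, p.1 i = 0 → r.1 i = 0) {δ : ℝ} (hδ : 0 < δ)
    {U : Set (stdSimplex ℝ (Fin t))} (hU : U ∈ 𝓝 r) :
    ∀ᶠ m : ℕ in atTop,
      ENNReal.ofReal (1 / 2 * Real.exp (-(m * (klSum r.1 p.1 + δ)))) ≤
        Measure.pi (fun _ : Fin m => discMeasure p.1) {y | empDistS ht y ∈ U} := by
  let V : Set (stdSimplex ℝ (Fin t)) :=
    {s | ∑ i, s.1 i * Real.log (r.1 i / p.1 i) < klSum r.1 p.1 + δ}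
  have hV : V ∈ 𝓝 r := by
    refine IsOpen.mem_nhds (isOpen_lt ?_ continuous_const) ?_
    · exact continuous_finsetSum _ fun i _ =>
        ((continuous_apply i).comp continuous_subtype_val).mul continuous_const
    · exact lt_add_of_pos_right _ hδ
  filter_upwards [eventually_half_le_pi_empDistS_mem ht r (inter_mem hU hV),
    eventually_gt_atTop 0] with m hhalf hm
  have hle := hhalf.trans (le_pi_empDistS_mem ht hm p r hac (U := U ∩ V) fun s hs => hs.2.le)
  set P := Measure.pi (fun _ : Fin m => discMeasure p.1) {y | empDistS ht y ∈ U ∩ V}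
  calc ENNReal.ofReal (1 / 2 * Real.exp (-(m * (klSum r.1 p.1 + δ))))
      = ENNReal.ofReal (Real.exp (-(m * (klSum r.1 p.1 + δ)))) * ENNReal.ofReal (1 / 2) := by
        rw [mul_comm, ENNReal.ofReal_mul (Real.exp_nonneg _)]
    _ ≤ ENNReal.ofReal (Real.exp (-(m * (klSum r.1 p.1 + δ)))) *
        (ENNReal.ofReal (Real.exp (m * (klSum r.1 p.1 + δ))) * P) := by gcongr
    _ = P := by
        rw [← mul_assoc, ← ENNReal.ofReal_mul (Real.exp_nonneg _), ← Real.exp_add]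
        simp
    _ ≤ _ := measure_mono fun y hy => hy.1

lemma tendsto_right_div_add {m n : ℕ → ℕ} {c : ℝ} (hm : Tendsto m atTop atTop)
    (hc : Tendsto (fun j : ℕ => (m j : ℝ) / (m j + n j)) atTop (𝓝 c)) :
    Tendsto (fun j : ℕ => (n j : ℝ) / (m j + n j)) atTop (𝓝 (1 - c)) := by
  refine (tendsto_const_nhds.sub hc).congr' ?_
  filter_upwards [hm.eventually_gt_atTop 0] with j hj
  have : (0 : ℝ) < m j := by positivity
  field_simp
  ring

/-- The probability that the pair of empirical distributions of independent samples of sizes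
`m` and `n` lies in `Γ`. -/
def pairProb {t : ℕ} (ht : 0 < t) (p q : stdSimplex ℝ (Fin t)) (m n : ℕ)
    (Γ : Set (stdSimplex ℝ (Fin t) × stdSimplex ℝ (Fin t))) : ℝ≥0∞ :=
  (Measure.pi (fun _ : Fin m => discMeasure p.1)).prod
    (Measure.pi (fun _ : Fin n => discMeasure q.1))
    {yx : (Fin m → Fin t) × (Fin n → Fin t) | (empDistS ht yx.1, empDistS ht yx.2) ∈ Γ}

lemma limsup_expRate_le_of_mem_interior {t : ℕ} (ht : 0 < t) (p q r s : stdSimplex ℝ (Fin t))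
    {m n : ℕ → ℕ} (hm : Tendsto m atTop atTop) (hn : Tendsto n atTop atTop)
    {c : ℝ} (hc0 : 0 < c) (hc1 : c < 1)
    (hc : Tendsto (fun j : ℕ => (m j : ℝ) / (m j + n j)) atTop (𝓝 c))
    {Γ : Set (stdSimplex ℝ (Fin t) × stdSimplex ℝ (Fin t))} (hrs : (r, s) ∈ interior Γ) :
    limsup (fun j => expRate (m j + n j) (pairProb ht p q (m j) (n j) Γ)) atTop
      ≤ ((ENNReal.ofReal c * finKL r.1 p.1 + ENNReal.ofReal (1 - c) * finKL s.1 q.1 : ℝ≥0∞) :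
        EReal) := by
  have hc0' : ENNReal.ofReal c ≠ 0 := (ENNReal.ofReal_pos.2 hc0).ne'
  have hc1' : ENNReal.ofReal (1 - c) ≠ 0 := (ENNReal.ofReal_pos.2 (by linarith)).ne'
  by_cases hr : ∀ i, p.1 i = 0 → r.1 i = 0
  swap
  · simp [finKL_of_not_ac hr, ENNReal.mul_top hc0']
  by_cases hs : ∀ i, q.1 i = 0 → s.1 i = 0
  swap
  · simp [finKL_of_not_ac hs, ENNReal.mul_top hc1']
  have hx := klSum_nonneg r p hr
  have hy := klSum_nonneg s q hs
  have hsum : 0 ≤ c * klSum r.1 p.1 + (1 - c) * klSum s.1 q.1 :=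
    add_nonneg (by positivity) (mul_nonneg (by linarith) hy)
  rw [finKL_of_ac hr, finKL_of_ac hs, ← ENNReal.ofReal_mul hc0.le,
    ← ENNReal.ofReal_mul (by linarith), ← ENNReal.ofReal_add (by positivity)
      (mul_nonneg (by linarith) hy), EReal.coe_ennreal_ofReal, max_eq_left hsum]
  refine EReal.le_of_forall_lt_iff_le.1 fun z hz => ?_
  rw [EReal.coe_lt_coe_iff] at hz
  set δ := z - (c * klSum r.1 p.1 + (1 - c) * klSum s.1 q.1) with hδ
  have hδ0 : 0 < δ := sub_pos.2 hz
  obtain ⟨U, hU, V, hV, hUV⟩ := mem_nhds_prod_iff.1 (mem_interior_iff_mem_nhds.1 hrs)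
  let u : ℕ → ℝ := fun j => (m j : ℝ) / (m j + n j) * (klSum r.1 p.1 + δ)
    + (n j : ℝ) / (m j + n j) * (klSum s.1 q.1 + δ) + Real.log 4 / ((m j : ℝ) + n j)
  have hu : Tendsto u atTop (𝓝 z) := by
    have hN : Tendsto (fun j => (m j : ℝ) + n j) atTop atTop :=
      (tendsto_natCast_atTop_atTop.comp hm).atTop_add_atTop (tendsto_natCast_atTop_atTop.comp hn)
    have := ((hc.mul_const (klSum r.1 p.1 + δ)).add
      ((tendsto_right_div_add hm hc).mul_const (klSum s.1 q.1 + δ))).add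
      (hN.const_div_atTop (Real.log 4))
    convert this using 2
    rw [hδ]
    ring
  calc _ ≤ limsup (fun j => (u j : EReal)) atTop := by
        refine limsup_le_limsup ?_
        filter_upwards [hm.eventually (eventually_le_pi_empDistS_mem ht p r hr hδ0 hU),
          hn.eventually (eventually_le_pi_empDistS_mem ht q s hs hδ0 hV),
          hm.eventually_gt_atTop 0] with j h1 h2 hmj
        refine expRate_le (by omega) ?_
        calc _ = ENNReal.ofReal (1 / 2 * Real.exp (-(m j * (klSum r.1 p.1 + δ))))
            * ENNReal.ofReal (1 / 2 * Real.exp (-(n j * (klSum s.1 q.1 + δ)))) := by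
              rw [← ENNReal.ofReal_mul (by positivity)]
              congr 1
              have hpos : (0 : ℝ) < m j := by positivity
              have h4 : -(((m j + n j : ℕ) : ℝ) * u j) = -Real.log 4
                  + (-(m j * (klSum r.1 p.1 + δ)) + -(n j * (klSum s.1 q.1 + δ))) := by
                simp only [u]
                push_cast
                field_simp
                ring
              rw [h4, Real.exp_add, Real.exp_add, Real.exp_neg, Real.exp_log (by norm_num)]
              ring
          _ ≤ _ := mul_le_mul' h1 h2
          _ ≤ pairProb ht p q (m j) (n j) Γ := by
              rw [← Measure.prod_prod]
              exact measure_mono fun yx hyx => hUV ⟨hyx.1, hyx.2⟩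
    _ = z := ((continuous_coe_real_ereal.tendsto z).comp hu).limsup_eq

lemma le_liminf_expRate {t : ℕ} (ht : 0 < t) (p q : stdSimplex ℝ (Fin t))
    {m n : ℕ → ℕ} (hm : Tendsto m atTop atTop) (hn : Tendsto n atTop atTop)
    {c : ℝ} (hc0 : 0 < c) (hc1 : c < 1)
    (hc : Tendsto (fun j : ℕ => (m j : ℝ) / (m j + n j)) atTop (𝓝 c))
    {Γ : Set (stdSimplex ℝ (Fin t) × stdSimplex ℝ (Fin t))} {b : ℝ}
    (hb : ∀ rs ∈ Γ, (b : EReal) ≤ ((ENNReal.ofReal c * finKL rs.1.1 p.1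
      + ENNReal.ofReal (1 - c) * finKL rs.2.1 q.1 : ℝ≥0∞) : EReal)) :
    (b : EReal) ≤ liminf (fun j => expRate (m j + n j) (pairProb ht p q (m j) (n j) Γ)) atTop := by
  have hc1' : 0 < 1 - c := by linarith
  let ρ : ℕ → ℝ := fun j => min ((m j : ℝ) / (m j + n j) / c) ((n j : ℝ) / (m j + n j) / (1 - c))
  have hρ : Tendsto ρ atTop (𝓝 1) := by
    have := (hc.div_const c).min ((tendsto_right_div_add hm hc).div_const (1 - c))
    rwa [div_self hc0.ne', div_self hc1'.ne', min_self] at this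
  let u : ℕ → ℝ := fun j =>
    ρ j * b - 2 * t * (Real.log ((m j + n j : ℕ) + 1) / (m j + n j : ℕ))
  have hu : Tendsto u atTop (𝓝 b) := by
    have := (hρ.mul_const b).sub
      ((tendsto_log_succ_div_atTop.comp (hm.atTop_add_atTop hn)).const_mul (2 * t : ℝ))
    simpa [u] using this
  calc (b : EReal) = liminf (fun j => (u j : EReal)) atTop :=
        ((continuous_coe_real_ereal.tendsto b).comp hu).liminf_eq.symm
    _ ≤ _ := by
        refine liminf_le_liminf ?_
        filter_upwards [hm.eventually_gt_atTop 0, hn.eventually_gt_atTop 0] with j hmj hnj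
        refine le_expRate (by omega) ?_
        have hpos : (0 : ℝ) < m j := by positivity
        refine (prod_pi_empDistS_mem_le ht hmj hnj p.1 q.1 Γ _ fun rs hrs =>
          pi_empDistS_eq_mul_le ht hmj hnj p q rs.1 rs.2 hc0.le hc1.le
            (M := (m j + n j : ℕ)) (ρ := ρ j) (by positivity) (by positivity) ?_ ?_
            (hb rs hrs)).trans (mul_ofReal_exp_le_ofReal_exp (by omega) _)
        · calc _ ≤ ((m j + n j : ℕ) : ℝ) * ((m j : ℝ) / (m j + n j) / c) * c := by
                gcongr
                exact min_le_left _ _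
            _ = m j := by push_cast; field_simp
        · calc _ ≤ ((m j + n j : ℕ) : ℝ) * ((n j : ℝ) / (m j + n j) / (1 - c)) * (1 - c) := by
                gcongr
                exact min_le_right _ _
            _ = n j := by push_cast; field_simp

/-- **Extended Sanov's theorem, finite alphabet.** For independent i.i.d. samples from
distributions `p` and `q` on the finite alphabet `{1,…,t}`, with sample sizes
`m_k, n_k → ∞` and `m_k/(m_k+n_k) → c ∈ (0,1)`, and any set `Γ` of pairs of distributions:
the exponential rate (in `m_k + n_k`) of `Prob((P̂_{m_k}, Q̂_{n_k}) ∈ Γ)` is bounded above by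
`inf_{(R,S) ∈ int Γ} [c D(R‖p) + (1-c) D(S‖q)]` and below by the corresponding infimum over
`cl Γ`, in the product topology on the product of two copies of the probability simplex. -/
theorem extended_sanov_finite_alphabet (t : ℕ) (ht : 0 < t)
    (p q : stdSimplex ℝ (Fin t))
    (m n : ℕ → ℕ) (hm : Tendsto m atTop atTop) (hn : Tendsto n atTop atTop)
    (c : ℝ) (hc0 : 0 < c) (hc1 : c < 1)
    (hc : Tendsto (fun j : ℕ => (m j : ℝ) / (m j + n j)) atTop (𝓝 c))
    (Γ : Set (stdSimplex ℝ (Fin t) × stdSimplex ℝ (Fin t))) :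
    limsup (fun j : ℕ => expRate (m j + n j)
        ((Measure.pi (fun _ : Fin (m j) => discMeasure p.1)).prod
          (Measure.pi (fun _ : Fin (n j) => discMeasure q.1))
          {yx : (Fin (m j) → Fin t) × (Fin (n j) → Fin t) |
            (empDistS ht yx.1, empDistS ht yx.2) ∈ Γ})) atTop
      ≤ ((⨅ RS ∈ interior Γ,
          ENNReal.ofReal c * finKL (RS.1 : Fin t → ℝ) (p : Fin t → ℝ)
            + ENNReal.ofReal (1 - c) * finKL (RS.2 : Fin t → ℝ) (q : Fin t → ℝ) :
          ℝ≥0∞) : EReal)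
    ∧ ((⨅ RS ∈ closure Γ,
          ENNReal.ofReal c * finKL (RS.1 : Fin t → ℝ) (p : Fin t → ℝ)
            + ENNReal.ofReal (1 - c) * finKL (RS.2 : Fin t → ℝ) (q : Fin t → ℝ) :
          ℝ≥0∞) : EReal)
      ≤ liminf (fun j : ℕ => expRate (m j + n j)
        ((Measure.pi (fun _ : Fin (m j) => discMeasure p.1)).prod
          (Measure.pi (fun _ : Fin (n j) => discMeasure q.1))
          {yx : (Fin (m j) → Fin t) × (Fin (n j) → Fin t) |
            (empDistS ht yx.1, empDistS ht yx.2) ∈ Γ})) atTop := by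
  refine ⟨?_, ?_⟩
  · refine ((le_max_right 0 _).trans_eq EReal.coe_toENNReal_eq_max.symm).trans
      (EReal.coe_ennreal_le_coe_ennreal_iff.2 ?_)
    refine le_iInf₂ fun rs hrs => ?_
    rw [← EReal.toENNReal_coe (x := _ + _)]
    exact EReal.toENNReal_le_toENNReal
      (limsup_expRate_le_of_mem_interior ht p q rs.1 rs.2 hm hn hc0 hc1 hc hrs)
  · refine EReal.ge_of_forall_gt_iff_ge.1 fun b hb => ?_
    refine le_liminf_expRate ht p q hm hn hc0 hc1 hc fun rs hrs => hb.le.trans ?_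
    exact EReal.coe_ennreal_le_coe_ennreal_iff.2 (iInf₂_le rs (subset_closure hrs))
end
end

section
/- Let X = {1, …, t} be a finite set, R a probability distribution on X, and y_1, …, y_m i.i.d. with law R, with empirical distribution P̂_m. Let P be a probability distribution on X of the form P(i) = m_i/m for nonnegative integers m_1, …, m_t summing to m (a type of denominator m). Then (m+1)^{−t} · e^{−m·D(P‖R)} ≤ Prob(P̂_m = P) ≤ e^{−m·D(P‖R)}. -/
open MeasureTheory Filter Topology ENNReal
open scoped Classical

noncomputable section
/-- `e^{-d}` for `d ∈ [0,∞]`, with the convention `e^{-∞} = 0`. -/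
def expNeg (d : ℝ≥0∞) : ℝ≥0∞ :=
  if d = ⊤ then 0 else ENNReal.ofReal (Real.exp (-d.toReal))

open Finset in
/-- The number of words of length `m` with prescribed letter counts is a multinomial
coefficient. -/
lemma card_filter_fiberCard_eq_multinomial {α : Type*} [Fintype α] [DecidableEq α] {m : ℕ} (c : α → ℕ)
    (hc : ∑ i, c i = m) :
    #{y : Fin m → α | ∀ i, #{j | y j = i} = c i} = Nat.multinomial univ c := by
  have key := (Fintype.sum_pow (fun i : α => (MvPolynomial.X i : MvPolynomial α ℕ)) m).symm.trans
    (sum_pow_eq_sum_piAntidiag univ _ m)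
  have monomial_eq (k : α → ℕ) : ∏ i, (MvPolynomial.X i : MvPolynomial α ℕ) ^ k i =
      MvPolynomial.monomial (Finsupp.equivFunOnFinite.symm k) 1 := by
    rw [MvPolynomial.monomial_eq, Finsupp.prod_fintype _ _ (by simp)]
    simp
  have word_eq (y : Fin m → α) : ∏ j, (MvPolynomial.X (y j) : MvPolynomial α ℕ) =
      MvPolynomial.monomial (Finsupp.equivFunOnFinite.symm fun i => #{j | y j = i}) 1 := by
    rw [← monomial_eq, ← prod_fiberwise univ y]
    exact prod_congr rfl fun i _ => prod_eq_pow_card fun j hj => by rw [(mem_filter.1 hj).2]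
  simp only [monomial_eq, word_eq] at key
  have h := congrArg (MvPolynomial.coeff (Finsupp.equivFunOnFinite.symm c)) key
  simp only [MvPolynomial.coeff_sum, ← map_natCast (MvPolynomial.C (σ := α) (R := ℕ)),
    MvPolynomial.coeff_C_mul, MvPolynomial.coeff_monomial, EmbeddingLike.apply_eq_iff_eq,
    mul_ite, mul_one, mul_zero, sum_ite_eq'] at h
  simpa [hc, funext_iff, sum_boole] using h

lemma factorial_mul_pow_le (a b : ℕ) :
    a.factorial * a ^ b ≤ b.factorial * a ^ a := by
  rcases le_total a b with h | h
  · calc a.factorial * a ^ b = a.factorial * a ^ (b - a) * a ^ a := by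
          rw [mul_assoc, ← pow_add, Nat.sub_add_cancel h]
      _ ≤ _ := Nat.mul_le_mul_right _ (Nat.factorial_mul_pow_sub_le_factorial h)
  · calc a.factorial * a ^ b ≤ b.factorial * a ^ (a - b) * a ^ b :=
          Nat.mul_le_mul_right _ <| by
            rw [← Nat.factorial_mul_descFactorial (Nat.sub_le a b), Nat.sub_sub_self h]
            exact Nat.mul_le_mul_left _ (Nat.descFactorial_le_pow _ _)
      _ = _ := by rw [mul_assoc, ← pow_add, Nat.sub_add_cancel h]

/-- Among the terms of the multinomial expansion of `(∑ i, c i) ^ (∑ i, c i)`, the one with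
exponent `c` is the largest. -/
lemma multinomial_mul_prod_pow_le {α : Type*} [Fintype α] (c k : α → ℕ)
    (h : ∑ i, k i = ∑ i, c i) :
    Nat.multinomial Finset.univ k * ∏ i, c i ^ k i ≤
      Nat.multinomial Finset.univ c * ∏ i, c i ^ c i := by
  have hle : ∏ i, ((c i).factorial * c i ^ k i) ≤ ∏ i, ((k i).factorial * c i ^ c i) :=
    Finset.prod_le_prod' fun i _ => factorial_mul_pow_le (c i) (k i)
  simp only [Finset.prod_mul_distrib] at hle
  have hspec := (Nat.multinomial_spec Finset.univ k).trans
    ((congrArg Nat.factorial h).trans (Nat.multinomial_spec Finset.univ c).symm)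
  have hpos : 0 < ∏ i, (k i).factorial := Finset.prod_pos fun i _ => (k i).factorial_pos
  refine Nat.le_of_mul_le_mul_left ?_ hpos
  calc (∏ i, (k i).factorial) * (Nat.multinomial Finset.univ k * ∏ i, c i ^ k i)
      = Nat.multinomial Finset.univ c * ((∏ i, (c i).factorial) * ∏ i, c i ^ k i) := by
        rw [← mul_assoc, hspec]; ring
    _ ≤ Nat.multinomial Finset.univ c * ((∏ i, (k i).factorial) * ∏ i, c i ^ c i) :=
        Nat.mul_le_mul_left _ hle
    _ = _ := by ring

lemma multinomial_mul_prod_pow_self_le {α : Type*} [Fintype α] {m : ℕ} (c : α → ℕ)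
    (hc : ∑ i, c i = m) :
    Nat.multinomial Finset.univ c * ∏ i, c i ^ c i ≤ m ^ m := by
  have h := Finset.sum_pow_eq_sum_piAntidiag Finset.univ c m
  rw [hc] at h
  rw [h]
  exact Finset.single_le_sum
    (f := fun k : α → ℕ => Nat.multinomial Finset.univ k * ∏ i, c i ^ k i)
    (fun _ _ => Nat.zero_le _) (by simp [hc])

lemma pow_self_le_mul_multinomial {α : Type*} [Fintype α] {m : ℕ} (c : α → ℕ)
    (hc : ∑ i, c i = m) :
    m ^ m ≤ (m + 1) ^ Fintype.card α *
      (Nat.multinomial Finset.univ c * ∏ i, c i ^ c i) := by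
  have h := Finset.sum_pow_eq_sum_piAntidiag Finset.univ c m
  rw [hc] at h
  have hsub : Finset.piAntidiag (Finset.univ : Finset α) m ⊆
      Fintype.piFinset fun _ => Finset.range (m + 1) := fun k hk => by
    simp only [Finset.mem_piAntidiag] at hk
    simp only [Fintype.mem_piFinset, Finset.mem_range, Nat.lt_succ_iff]
    exact fun i => hk.1 ▸ Finset.single_le_sum (fun _ _ => Nat.zero_le _) (Finset.mem_univ i)
  have hcard := Finset.card_le_card hsub
  simp only [Fintype.card_piFinset, Finset.card_range, Finset.prod_const, Finset.card_univ] at hcard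
  rw [h]
  refine (Finset.sum_le_card_nsmul _ _ (Nat.multinomial Finset.univ c * ∏ i, c i ^ c i)
    fun k hk => ?_).trans ?_
  · exact multinomial_mul_prod_pow_le c k ((Finset.mem_piAntidiag.1 hk).1.trans hc.symm)
  · rw [smul_eq_mul]
    exact Nat.mul_le_mul_right _ hcard

lemma empDist_eq_iff {t m : ℕ} (c : Fin t → ℕ) (hc : ∑ i, c i = m) (y : Fin m → Fin t) :
    (empDist y = fun i => (c i : ℝ) / m) ↔
      ∀ i, (Finset.univ.filter fun j => y j = i).card = c i := by
  rcases Nat.eq_zero_or_pos m with rfl | hm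
  · have hc0 (i : Fin t) : c i = 0 := by simp_all
    simp [empDist, funext_iff, hc0]
  · have hm' : (m : ℝ) ≠ 0 := by positivity
    simp [empDist, funext_iff, div_left_inj' hm']

/-- The probability of a type class is its cardinality times the common probability of its
elements. -/
lemma pi_discMeasure_typeClass {t m : ℕ} (r : Fin t → ℝ) (hr0 : ∀ i, 0 ≤ r i)
    (c : Fin t → ℕ) (hc : ∑ i, c i = m) :
    Measure.pi (fun _ : Fin m => discMeasure r)
        {y : Fin m → Fin t | empDist y = fun i => (c i : ℝ) / m} =
      ENNReal.ofReal (Nat.multinomial Finset.univ c * ∏ i, r i ^ c i) := by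
  have hset : {y : Fin m → Fin t | empDist y = fun i => (c i : ℝ) / m} =
      ((Finset.univ.filter fun y : Fin m → Fin t =>
        ∀ i, (Finset.univ.filter fun j => y j = i).card = c i : Finset _) : Set _) := by
    ext y
    simp [empDist_eq_iff c hc]
  rw [hset, ← sum_measure_singleton, Finset.sum_congr rfl
    (g := fun _ => ENNReal.ofReal (∏ i, r i ^ c i)), Finset.sum_const]
  · rw [ENNReal.ofReal_mul (Nat.cast_nonneg _), ENNReal.ofReal_natCast, nsmul_eq_mul,
      ← card_filter_fiberCard_eq_multinomial c hc]
    congr!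
  · intro y hy
    rw [Measure.pi_singleton]
    simp only [discMeasure_singleton]
    rw [← ENNReal.ofReal_prod_of_nonneg fun j _ => hr0 (y j), ← Finset.prod_fiberwise _ y]
    congr 1
    refine Finset.prod_congr rfl fun i _ => ?_
    rw [← (Finset.mem_filter.1 hy).2 i]
    exact Finset.prod_eq_pow_card fun j hj => by rw [(Finset.mem_filter.1 hj).2]

/-- Gibbs' inequality. -/
lemma sum_mul_log_div_nonneg {ι : Type*} [Fintype ι] (p q : ι → ℝ) (hp : ∀ i, 0 ≤ p i)
    (hq : ∀ i, 0 ≤ q i) (hpq : ∑ i, q i ≤ ∑ i, p i) (hac : ∀ i, q i = 0 → p i = 0) :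
    0 ≤ ∑ i, p i * Real.log (p i / q i) := by
  have h (i : ι) : p i - q i ≤ p i * Real.log (p i / q i) := by
    rcases (hp i).eq_or_lt with hi | hi
    · simp [← hi, hq i]
    have hqi : 0 < q i := (hq i).lt_of_ne fun h0 => hi.ne' (hac i h0.symm)
    have := mul_le_mul_of_nonneg_left (Real.one_sub_inv_le_log_of_pos (div_pos hi hqi)) hi.le
    refine le_of_eq_of_le ?_ this
    field_simp
  calc 0 ≤ ∑ i, (p i - q i) := by simpa using hpq
    _ ≤ _ := Finset.sum_le_sum fun i _ => h i

/-- The exponential of the divergence from a type, with denominators cleared. -/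
lemma exp_neg_mul_sum_log_mul_prod {t m : ℕ} (r : Fin t → ℝ) (hr0 : ∀ i, 0 ≤ r i)
    (c : Fin t → ℕ) (hc : ∑ i, c i = m) (hac : ∀ i, r i = 0 → (c i : ℝ) / m = 0) :
    Real.exp (-(m * ∑ i, (c i : ℝ) / m * Real.log ((c i : ℝ) / m / r i))) *
      ∏ i, (c i : ℝ) ^ c i = m ^ m * ∏ i, r i ^ c i := by
  have hpow : (m : ℝ) ^ m = ∏ i, (m : ℝ) ^ c i := by rw [Finset.prod_pow_eq_pow_sum, hc]
  rw [hpow, Finset.mul_sum, ← Finset.sum_neg_distrib, Real.exp_sum, ← Finset.prod_mul_distrib,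
    ← Finset.prod_mul_distrib]
  refine Finset.prod_congr rfl fun i _ => ?_
  rcases Nat.eq_zero_or_pos (c i) with hi | hi
  · simp [hi]
  have hm : 0 < m := hi.trans_le (hc ▸ Finset.single_le_sum (fun _ _ => Nat.zero_le _)
    (Finset.mem_univ i))
  have hri : 0 < r i := (hr0 i).lt_of_ne fun h0 =>
    (by positivity : (c i : ℝ) / m ≠ 0) (hac i h0.symm)
  have hx : 0 < (c i : ℝ) / m / r i := by positivity
  have hlog : -((m : ℝ) * ((c i : ℝ) / m * Real.log ((c i : ℝ) / m / r i))) =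
      c i * Real.log ((c i : ℝ) / m / r i)⁻¹ := by
    rw [Real.log_inv]
    field_simp
  rw [hlog, Real.exp_nat_mul, Real.exp_log (inv_pos.2 hx), ← mul_pow, ← mul_pow]
  congr 1
  field_simp

lemma expNeg_mul_finKL_type {t m : ℕ} (r : Fin t → ℝ) (hr0 : ∀ i, 0 ≤ r i)
    (hr1 : ∑ i, r i = 1) (c : Fin t → ℕ) (hc : ∑ i, c i = m) :
    expNeg ((m : ℝ≥0∞) * finKL (fun i => (c i : ℝ) / m) r) =
      ENNReal.ofReal (m ^ m * (∏ i, r i ^ c i) / ∏ i, (c i : ℝ) ^ c i) := by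
  have hprod : 0 < ∏ i, (c i : ℝ) ^ c i := Finset.prod_pos fun i _ => by
    exact_mod_cast Nat.pow_self_pos
  by_cases hac : ∀ i, r i = 0 → (c i : ℝ) / m = 0
  · have hnonneg : 0 ≤ m * ∑ i, (c i : ℝ) / m * Real.log ((c i : ℝ) / m / r i) := by
      rcases Nat.eq_zero_or_pos m with rfl | hm
      · simp
      refine mul_nonneg m.cast_nonneg (sum_mul_log_div_nonneg _ _ (fun i => by positivity) hr0
        (le_of_eq ?_) hac)
      rw [hr1, ← Finset.sum_div, ← Nat.cast_sum, hc, div_self (by positivity)]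
    rw [finKL, if_pos hac, ← ENNReal.ofReal_natCast, ← ENNReal.ofReal_mul m.cast_nonneg, expNeg,
      if_neg ENNReal.ofReal_ne_top, ENNReal.toReal_ofReal hnonneg,
      ← exp_neg_mul_sum_log_mul_prod r hr0 c hc hac, mul_div_cancel_right₀ _ hprod.ne']
  · rw [finKL, if_neg hac]
    push Not at hac
    obtain ⟨i, hri, hci⟩ := hac
    obtain ⟨hci, hm⟩ := div_ne_zero_iff.1 hci
    have h0 : ∏ i, r i ^ c i = 0 := Finset.prod_eq_zero (Finset.mem_univ i) <| by
      rw [hri, zero_pow (by exact_mod_cast hci)]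
    rw [ENNReal.mul_top (by exact_mod_cast hm), expNeg, if_pos rfl, h0]
    simp

/-- **Probability of a type class.** If `y_1,…,y_m` are i.i.d. with law `R` on the finite
alphabet `{1,…,t}` and `P` is a type of denominator `m` (i.e. `P(i) = m_i/m` with the `m_i`
nonnegative integers summing to `m`), then
`(m+1)^{-t} e^{-m D(P‖R)} ≤ Prob(P̂_m = P) ≤ e^{-m D(P‖R)}`. -/
theorem type_class_probability (t m : ℕ) (r : Fin t → ℝ)
    (hr0 : ∀ i, 0 ≤ r i) (hr1 : ∑ i, r i = 1)
    (counts : Fin t → ℕ) (hcounts : ∑ i, counts i = m) :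
    (((m : ℝ≥0∞) + 1) ^ t)⁻¹ * expNeg ((m : ℝ≥0∞) * finKL (fun i => (counts i : ℝ) / m) r)
        ≤ Measure.pi (fun _ : Fin m => discMeasure r)
            {y : Fin m → Fin t | empDist y = fun i => (counts i : ℝ) / m}
    ∧ Measure.pi (fun _ : Fin m => discMeasure r)
          {y : Fin m → Fin t | empDist y = fun i => (counts i : ℝ) / m}
        ≤ expNeg ((m : ℝ≥0∞) * finKL (fun i => (counts i : ℝ) / m) r) := by
  rw [pi_discMeasure_typeClass r hr0 counts hcounts,
    expNeg_mul_finKL_type r hr0 hr1 counts hcounts]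
  have hprod : 0 < ∏ i, (counts i : ℝ) ^ counts i := Finset.prod_pos fun i _ => by
    exact_mod_cast Nat.pow_self_pos
  have hrprod : 0 ≤ ∏ i, r i ^ counts i := Finset.prod_nonneg fun i _ => pow_nonneg (hr0 i) _
  have hlower : (m : ℝ) ^ m ≤ (m + 1) ^ t *
      (Nat.multinomial Finset.univ counts * ∏ i, (counts i : ℝ) ^ counts i) := by
    have := pow_self_le_mul_multinomial counts hcounts
    rw [Fintype.card_fin] at this
    exact_mod_cast this
  have hupper : Nat.multinomial Finset.univ counts * ∏ i, (counts i : ℝ) ^ counts i ≤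
      (m : ℝ) ^ m := by
    exact_mod_cast multinomial_mul_prod_pow_self_le counts hcounts
  constructor
  · have hbase : ((m : ℝ≥0∞) + 1) ^ t = ENNReal.ofReal (((m : ℝ) + 1) ^ t) := by
      rw [ENNReal.ofReal_pow (by positivity), ENNReal.ofReal_add (by positivity) zero_le_one,
        ENNReal.ofReal_natCast, ENNReal.ofReal_one]
    rw [hbase, ← ENNReal.ofReal_inv_of_pos (by positivity), ← ENNReal.ofReal_mul (by positivity)]
    refine ENNReal.ofReal_le_ofReal ?_
    rw [inv_mul_le_iff₀ (by positivity), div_le_iff₀ hprod]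
    calc _ ≤ _ := mul_le_mul_of_nonneg_right hlower hrprod
      _ = _ := by ring
  · refine ENNReal.ofReal_le_ofReal ?_
    rw [le_div_iff₀ hprod]
    calc _ = (Nat.multinomial Finset.univ counts * ∏ i, (counts i : ℝ) ^ counts i) *
          ∏ i, r i ^ counts i := by ring
      _ ≤ _ := mul_le_mul_of_nonneg_right hupper hrprod
end
end

section
/- Let X be a Polish space and Γ ⊆ P(X) × P(X). For each finite measurable partition 𝒜 = {A_1, …, A_t} of X, define Γ(𝒜) = { (R,S) ∈ P(X)×P(X) : there exists (R′,S′) ∈ Γ with R(A_i) = R′(A_i) and S(A_i) = S′(A_i) for all i = 1,…,t }. Then the closure of Γ in the product of the weak topologies satisfies cl Γ = ⋂_𝒜 cl Γ(𝒜), where the intersection runs over all finite measurable partitions 𝒜 of X and closures are taken in the product weak topology. -/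
open MeasureTheory Filter Topology ENNReal
open scoped Classical

noncomputable section

open scoped BoundedContinuousFunction

/-- The weak topology on pairs of probability measures is induced by the integrals of bounded
continuous functions. -/
theorem isInducing_integral_prod {X : Type*} [MeasurableSpace X] [TopologicalSpace X]
    [OpensMeasurableSpace X] :
    IsInducing (fun (RS : ProbabilityMeasure X × ProbabilityMeasure X) (f : X →ᵇ ℝ) =>
      (∫ x, f x ∂(RS.1 : Measure X), ∫ x, f x ∂(RS.2 : Measure X))) := by
  refine isInducing_iff_nhds.2 fun p => le_antisymm ?_ ?_
  · rw [← tendsto_iff_comap, tendsto_pi_nhds]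
    intro f
    exact Tendsto.prodMk_nhds
      (ProbabilityMeasure.tendsto_iff_forall_integral_tendsto.1 continuous_fst.continuousAt f)
      (ProbabilityMeasure.tendsto_iff_forall_integral_tendsto.1 continuous_snd.continuousAt f)
  · have h := tendsto_pi_nhds.1 (tendsto_comap (f := fun
      (RS : ProbabilityMeasure X × ProbabilityMeasure X) (f : X →ᵇ ℝ) =>
      (∫ x, f x ∂(RS.1 : Measure X), ∫ x, f x ∂(RS.2 : Measure X)))
      (x := 𝓝 fun f => (∫ x, f x ∂(p.1 : Measure X), ∫ x, f x ∂(p.2 : Measure X))))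
    exact tendsto_id'.1 (Tendsto.prodMk_nhds (x := p.1) (y := p.2)
      (ProbabilityMeasure.tendsto_iff_forall_integral_tendsto.2 fun f =>
        (continuous_fst.tendsto _).comp (h f))
      (ProbabilityMeasure.tendsto_iff_forall_integral_tendsto.2 fun f =>
        (continuous_snd.tendsto _).comp (h f)))

/-- Finitely many bounded continuous functions are simultaneously approximated, up to prescribed
errors, by functions of one measurable map with finitely many values. -/
theorem exists_measurable_fin_approx {X : Type*} [MeasurableSpace X] [TopologicalSpace X]
    [OpensMeasurableSpace X] {I : Set (X →ᵇ ℝ)} (hI : I.Finite) {δ : (X →ᵇ ℝ) → ℝ}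
    (hδ : ∀ f ∈ I, 0 < δ f) :
    ∃ (t : ℕ) (g : X → Fin t), Measurable g ∧
      ∀ f ∈ I, ∃ φ : Fin t → ℝ, ∀ x, |f x - φ (g x)| ≤ δ f := by
  have : Finite I := hI
  let G : X → I → ℤ := fun x f => ⌊f.1 x / δ f.1⌋
  have hG : Measurable G := measurable_pi_lambda _ fun f =>
    Int.measurable_floor.comp (f.1.continuous.measurable.div_const _)
  have hfin : (Set.range G).Finite := by
    refine (Set.Finite.pi' fun f : I =>
      Set.finite_Icc ⌊-‖f.1‖ / δ f.1⌋ ⌊‖f.1‖ / δ f.1⌋).subset ?_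
    rintro _ ⟨x, rfl⟩ f
    have h := abs_le.1 (f.1.norm_coe_le_norm x)
    have hp := (hδ f.1 f.2).le
    exact ⟨Int.floor_le_floor (div_le_div_of_nonneg_right h.1 hp),
      Int.floor_le_floor (div_le_div_of_nonneg_right h.2 hp)⟩
  have : Finite (Set.range G) := hfin
  obtain ⟨t, ⟨e⟩⟩ := Finite.exists_equiv_fin (Set.range G)
  refine ⟨t, fun x => e ⟨G x, x, rfl⟩,
    (measurable_of_countable e).comp (hG.subtype_mk), fun f hf =>
    ⟨fun j => δ f * ((e.symm j).1 ⟨f, hf⟩ : ℤ), fun x => ?_⟩⟩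
  have hp := hδ f hf
  simp only [Equiv.symm_apply_apply, G]
  have h1 := Int.floor_le (f x / δ f)
  have h2 := (Int.lt_floor_add_one (f x / δ f)).le
  rw [le_div_iff₀ hp] at h1
  rw [div_le_iff₀ hp] at h2
  exact abs_le.2 ⟨by linarith, by linarith⟩

/-- If two probability measures have the same image under `g`, then they nearly agree on functions
that are nearly functions of `g`. -/
theorem abs_integral_sub_le_of_map_eq {X ι : Type*} [MeasurableSpace X] [Finite ι]
    [MeasurableSpace ι] [MeasurableSingletonClass ι] {μ ν : Measure X} [IsProbabilityMeasure μ]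
    [IsProbabilityMeasure ν] {g : X → ι} (hg : Measurable g) (hmap : μ.map g = ν.map g)
    {f : X → ℝ} (hμ : Integrable f μ) (hν : Integrable f ν) {φ : ι → ℝ} {δ : ℝ}
    (hφ : ∀ x, |f x - φ (g x)| ≤ δ) :
    |∫ x, f x ∂μ - ∫ x, f x ∂ν| ≤ 2 * δ := by
  have key : ∀ (ρ : Measure X) [IsProbabilityMeasure ρ], Integrable f ρ →
      |∫ x, f x ∂ρ - ∫ i, φ i ∂(ρ.map g)| ≤ δ := by
    intro ρ _ hρ
    have := Measure.isProbabilityMeasure_map (μ := ρ) hg.aemeasurable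
    have hφi : Integrable φ (ρ.map g) := .of_finite
    rw [integral_map hg.aemeasurable hφi.aestronglyMeasurable,
      ← integral_sub (g := fun x => φ (g x)) hρ (hφi.comp_measurable hg)]
    simpa using norm_integral_le_of_norm_le_const (μ := ρ) (f := fun x => f x - φ (g x))
      (ae_of_all _ hφ)
  have h1 := abs_le.1 (key μ hμ)
  have h2 := abs_le.1 (key ν hν)
  rw [hmap] at h1
  exact abs_le.2 ⟨by linarith, by linarith⟩

/-- For `Γ` a set of pairs of Borel probability measures on a Polish space, the closure of `Γ`
in the product of the weak topologies equals the intersection, over all finite measurable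
partitions `𝒜 = {A_1,…,A_t}` of the space, of the closures of the sets
`Γ(𝒜) = {(R,S) : ∃ (R',S') ∈ Γ, R(A_i) = R'(A_i) and S(A_i) = S'(A_i) for all i}`. -/
theorem closure_eq_iInter_partition_closures {X : Type*} [MeasurableSpace X]
    [TopologicalSpace X] [PolishSpace X] [BorelSpace X]
    (Γ : Set (ProbabilityMeasure X × ProbabilityMeasure X)) :
    closure Γ =
      ⋂ (t : ℕ), ⋂ (A : Fin t → Set X),
        ⋂ (_ : (∀ i, MeasurableSet (A i)) ∧ (Pairwise fun i j => Disjoint (A i) (A j)) ∧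
            (⋃ i, A i) = Set.univ),
          closure {RS : ProbabilityMeasure X × ProbabilityMeasure X |
            ∃ RS' ∈ Γ, ∀ i,
              (RS.1 : Measure X) (A i) = (RS'.1 : Measure X) (A i) ∧
              (RS.2 : Measure X) (A i) = (RS'.2 : Measure X) (A i)} := by
  refine subset_antisymm ?_ fun p hp => ?_
  · simp only [Set.subset_iInter_iff]
    exact fun t A _ => closure_mono fun RS h => ⟨RS, h, fun _ => ⟨rfl, rfl⟩⟩
  have hbasis (v : (X →ᵇ ℝ) → ℝ × ℝ) :=
    nhds_pi (a := v) ▸ hasBasis_pi fun f => Metric.nhds_basis_ball (x := v f)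
  rw [isInducing_integral_prod.closure_eq_preimage_closure_image, Set.mem_preimage,
    mem_closure_iff_nhds_basis (hbasis _)]
  rintro ⟨I, r⟩ ⟨hI, hr⟩
  obtain ⟨t, g, hg, happ⟩ := exists_measurable_fin_approx hI (δ := fun f => r f / 4)
    fun f hf => div_pos (hr f hf) (by norm_num)
  simp only [Set.mem_iInter] at hp
  have hcl := hp t (fun i => g ⁻¹' {i}) ⟨fun i => hg (measurableSet_singleton i),
    fun i j hij => (Set.disjoint_singleton.2 hij).preimage g,
    Set.eq_univ_of_forall fun x => Set.mem_iUnion.2 ⟨g x, rfl⟩⟩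
  rw [isInducing_integral_prod.closure_eq_preimage_closure_image, Set.mem_preimage,
    mem_closure_iff_nhds_basis (hbasis _)] at hcl
  obtain ⟨_, ⟨RS, ⟨RS', hΓ, hRS⟩, rfl⟩, hball⟩ := hcl (I, fun f => r f / 2)
    ⟨hI, fun f hf => half_pos (hr f hf)⟩
  refine ⟨_, ⟨RS', hΓ, rfl⟩, fun f hf => ?_⟩
  obtain ⟨φ, hφ⟩ := happ f hf
  have hmap : ∀ {μ ν : Measure X}, (∀ i, μ (g ⁻¹' {i}) = ν (g ⁻¹' {i})) →
      μ.map g = ν.map g := fun h => Measure.ext_of_singleton fun i => by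
    rw [Measure.map_apply hg (measurableSet_singleton i),
      Measure.map_apply hg (measurableSet_singleton i), h i]
  have h1 := abs_integral_sub_le_of_map_eq hg (hmap fun i => (hRS i).1.symm)
    (f.integrable _) (f.integrable _) hφ
  have h2 := abs_integral_sub_le_of_map_eq hg (hmap fun i => (hRS i).2.symm)
    (f.integrable _) (f.integrable _) hφ
  have hb := hball f hf
  simp only [Metric.mem_ball, Prod.dist_eq, sup_lt_iff, Real.dist_eq] at hb ⊢
  exact ⟨(abs_sub_le _ _ _).trans_lt (by linarith [hb.1]),
    (abs_sub_le _ _ _).trans_lt (by linarith [hb.2])⟩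
end
end
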